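/- For every ε > 0 there exists a constant c_ε > 0 such that the following holds. Let p be a prime and A ⊆ F_p a finite set with |A|·|A−A|·|A²−A²| ≤ p². Then either |A−A|^{27}·|A²−A²|^{17} ≥ c_ε·p^{−ε}·|A|^{53}, or |A−A|^{13}·|A²−A²|^{7} ≥ c_ε·p^{−ε}·|A|^{25}. (Equivalently, with M := |A−A|/|A| and K := |A²−A²|/|A|: M^{27}K^{17} ≳ |A|^{9} or M^{13}K^{7} ≳ |A|^{5}.) -/

import Mathlib

open Finset Pointwise

namespace FpSumProd

/-- `A² = {a² : a ∈ A}`. -/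
def sqSet {p : ℕ} (A : Finset (ZMod p)) : Finset (ZMod p) := A.image fun a => a ^ 2

/-- `A² - A² = {a² - b² : a, b ∈ A}` (here `A - B` denotes the pointwise difference set). -/
def sqDiff {p : ℕ} (A : Finset (ZMod p)) : Finset (ZMod p) := sqSet A - sqSet A

section Lines

open MvPolynomial

variable {K : Type*} [Field K]

/-- The point with parameter `x` on the line `y = u + t x`, `z = w + t u + t² x`, where
`q = (t, u, w)`. -/
def linePt (q : K × K × K) (x : K) : Fin 3 → K :=
  ![x, q.2.1 + q.1 * x, q.2.2 + q.1 * q.2.1 + q.1 ^ 2 * x]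

/-- The restriction of a polynomial in three variables to the line `q`. -/
noncomputable def lineRestrict (q : K × K × K) : MvPolynomial (Fin 3) K →ₐ[K] Polynomial K :=
  aeval ![Polynomial.X, Polynomial.C q.2.1 + Polynomial.C q.1 * Polynomial.X,
    Polynomial.C (q.2.2 + q.1 * q.2.1) + Polynomial.C (q.1 ^ 2) * Polynomial.X]

lemma eval_lineRestrict (q : K × K × K) (G : MvPolynomial (Fin 3) K) (x : K) :
    (lineRestrict q G).eval x = eval (linePt q x) G := by
  induction G using MvPolynomial.induction_on with
  | C a => simp [lineRestrict]
  | add p q hp hq => simp [hp, hq]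
  | mul_X p i hp =>
    rw [map_mul, Polynomial.eval_mul, hp, map_mul]
    congr 1
    fin_cases i <;> simp [lineRestrict, linePt]

lemma natDegree_lineRestrict_le (q : K × K × K) (G : MvPolynomial (Fin 3) K) :
    (lineRestrict q G).natDegree ≤ G.totalDegree := by
  have := aeval_natDegree_le (m := G.totalDegree) (n := 1) G le_rfl
    ![Polynomial.X, Polynomial.C q.2.1 + Polynomial.C q.1 * Polynomial.X,
      Polynomial.C (q.2.2 + q.1 * q.2.1) + Polynomial.C (q.1 ^ 2) * Polynomial.X] (by
      intro i
      fin_cases i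
      · simp
      · simp only [Fin.mk_one, Matrix.cons_val_one, Matrix.cons_val_zero]
        compute_degree
      · simp only [Fin.reduceFinMk, Matrix.cons_val]
        compute_degree)
  simpa [lineRestrict] using this

lemma lineRestrict_eq_zero_of_card {q : K × K × K} {G : MvPolynomial (Fin 3) K} (s : Finset K)
    (hs : ∀ x ∈ s, eval (linePt q x) G = 0) (hcard : G.totalDegree < #s) :
    lineRestrict q G = 0 :=
  Polynomial.eq_zero_of_natDegree_lt_card_of_eval_eq_zero' _ s
    (fun x hx => by rw [eval_lineRestrict, hs x hx])
    ((natDegree_lineRestrict_le q G).trans_lt hcard)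

lemma eval_linePt_of_lineRestrict {q : K × K × K} {G : MvPolynomial (Fin 3) K}
    (h : lineRestrict q G = 0) (x : K) : eval (linePt q x) G = 0 := by
  rw [← eval_lineRestrict, h, Polynomial.eval_zero]

lemma lineRestrict_eq_zero_of_forall [Infinite K] {q : K × K × K} {G : MvPolynomial (Fin 3) K}
    (h : ∀ x, eval (linePt q x) G = 0) : lineRestrict q G = 0 :=
  Polynomial.funext fun x => by rw [eval_lineRestrict, h, Polynomial.eval_zero]

lemma exists_separating {q r : K × K × K} (h : q ≠ r) :
    ∃ Λ : MvPolynomial (Fin 3) K, Λ.totalDegree ≤ 1 ∧ lineRestrict r Λ = 0 ∧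
      lineRestrict q Λ ≠ 0 := by
  have hX : ∀ i : Fin 3, (X i : MvPolynomial (Fin 3) K).totalDegree ≤ 1 := fun i => by
    rw [totalDegree_X]
  have hC : ∀ a b : K, ∀ i : Fin 3,
      (X i - C a - C b * X 0 : MvPolynomial (Fin 3) K).totalDegree ≤ 1 := by
    intro a b i
    refine (totalDegree_sub _ _).trans (max_le ((totalDegree_sub _ _).trans
      (max_le (hX i) (by simp))) ((totalDegree_mul _ _).trans ?_))
    simp
  by_cases h1 : q.1 = r.1 ∧ q.2.1 = r.2.1
  · refine ⟨X 2 - C (r.2.2 + r.1 * r.2.1) - C (r.1 ^ 2) * X 0, hC _ _ _, ?_, ?_⟩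
    · simp [lineRestrict]
    · intro h0
      apply h
      have := congrArg (Polynomial.coeff · 0) h0
      simp only [lineRestrict, map_sub, map_mul, aeval_X, aeval_C] at this
      simp [h1.1, h1.2] at this
      refine Prod.ext h1.1 (Prod.ext h1.2 ?_)
      linear_combination this
  · refine ⟨X 1 - C (r.2.1) - C (r.1) * X 0, hC _ _ _, ?_, ?_⟩
    · simp [lineRestrict]
    · intro h0
      apply h1
      have h2 := congrArg (Polynomial.coeff · 0) h0
      have h3 := congrArg (Polynomial.coeff · 1) h0
      simp only [lineRestrict, map_sub, map_mul, aeval_X, aeval_C] at h2 h3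
      simp at h2 h3
      exact ⟨by linear_combination h3, by linear_combination h2⟩

lemma finrank_restrictTotalDegree (m : ℕ) :
    Module.finrank K (restrictTotalDegree (Fin 3) K m) = (m + 3).choose 3 := by
  have key : ({n : Fin 3 →₀ ℕ | (n.sum fun _ e => e) ≤ m} : Set (Fin 3 →₀ ℕ)) =
      ↑((range (m + 1)).biUnion fun j => (univ : Finset (Fin 3)).finsuppAntidiag j) := by
    ext s
    simp [mem_finsuppAntidiag, Finsupp.sum_fintype]
  have h1 : Module.finrank K (restrictTotalDegree (Fin 3) K m) =
      Nat.card {n : Fin 3 →₀ ℕ | (n.sum fun _ e => e) ≤ m} :=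
    Module.finrank_eq_nat_card_basis (basisRestrictSupport K _)
  rw [h1, key]
  simp only [SetLike.coe_sort_coe, Nat.card_eq_fintype_card, Fintype.card_coe]
  rw [card_biUnion]
  · simp only [card_finsuppAntidiag_nat_eq_choose, card_univ, Fintype.card_fin]
    clear h1 key
    induction m with
    | zero => simp
    | succ m ih =>
      rw [sum_range_succ, ih, show 3 + (m + 1) - 1 = m + 3 by omega,
        show m + 1 + 3 = (m + 3) + 1 by omega, Nat.choose_succ_succ' (m + 3) 2, add_comm,
        ← Nat.choose_symm_of_eq_add (show m + 3 = (m + 1) + 2 by omega)]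
  · intro i _ j _ hij
    rw [Function.onFun, Finset.disjoint_left]
    intro s hs ht
    simp only [mem_finsuppAntidiag] at hs ht
    exact hij (hs.1.symm.trans ht.1)

end Lines

section Bezout

open MvPolynomial

variable {K : Type*} [Field K]

lemma totalDegree_aeval_X_le (f : Polynomial K) (i : Fin 3) :
    (Polynomial.aeval (X i : MvPolynomial (Fin 3) K) f).totalDegree ≤ f.natDegree := by
  rw [Polynomial.aeval_eq_sum_range]
  refine totalDegree_finsetSum_le fun j hj => (totalDegree_smul_le _ _).trans ?_
  rw [totalDegree_X_pow]
  exact Nat.lt_succ_iff.mp (mem_range.mp hj)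

lemma lineRestrict_aeval_X (q : K × K × K) (f : Polynomial K) :
    lineRestrict q (Polynomial.aeval (X 0) f) = f := by
  rw [← Polynomial.aeval_algHom_apply]
  simp [lineRestrict]

/-- For every line of a finite family, a polynomial that vanishes on all other lines of the
family but not on this one. -/
lemma exists_separating_family (S : Finset (K × K × K)) (q : K × K × K) :
    ∃ Λ : MvPolynomial (Fin 3) K, Λ.totalDegree ≤ #S ∧ lineRestrict q Λ ≠ 0 ∧
      ∀ r ∈ S, r ≠ q → lineRestrict r Λ = 0 := by
  classical
  have H : ∀ r, ∃ Λ : MvPolynomial (Fin 3) K, q ≠ r → (Λ.totalDegree ≤ 1 ∧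
      lineRestrict r Λ = 0 ∧ lineRestrict q Λ ≠ 0) := by
    intro r
    by_cases h : q = r
    · exact ⟨0, fun h' => absurd h h'⟩
    · obtain ⟨Λ, hΛ⟩ := exists_separating h
      exact ⟨Λ, fun _ => hΛ⟩
  choose Λ hΛ using H
  refine ⟨∏ r ∈ S.erase q, Λ r, ?_, ?_, ?_⟩
  · refine (totalDegree_finsetProd _ _).trans ((sum_le_card_nsmul _ _ 1 ?_).trans ?_)
    · intro r hr
      exact (hΛ r (ne_of_mem_erase hr).symm).1
    · simpa using (card_erase_le)
  · rw [map_prod, prod_ne_zero_iff]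
    intro r hr
    exact (hΛ r (ne_of_mem_erase hr).symm).2.2
  · intro r hr hrq
    rw [map_prod]
    exact prod_eq_zero (mem_erase.mpr ⟨hrq, hr⟩) (hΛ r hrq.symm).2.1

lemma card_mul_add_choose_le {G H : MvPolynomial (Fin 3) K} (hG : Prime G) (hGH : ¬ G ∣ H)
    (S : Finset (K × K × K)) (hSG : ∀ q ∈ S, lineRestrict q G = 0)
    (hSH : ∀ q ∈ S, lineRestrict q H = 0) (M a : ℕ)
    (hM : M + #S ≤ a + G.totalDegree + H.totalDegree) :
    #S * M + (a + H.totalDegree + 3).choose 3 + (a + G.totalDegree + 3).choose 3 ≤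
      (a + G.totalDegree + H.totalDegree + 3).choose 3 + (a + 3).choose 3 := by
  classical
  have hH0 : H ≠ 0 := fun h => hGH (h ▸ dvd_zero G)
  have hG0 := hG.ne_zero
  set d := G.totalDegree with hd
  set e := H.totalDegree with he
  choose Λ hΛ using fun q : S => exists_separating_family S q.1
  let V := (S → Polynomial.degreeLT K M) × restrictTotalDegree (Fin 3) K (a + e) ×
    restrictTotalDegree (Fin 3) K (a + d)
  let ψ : S → (Polynomial.degreeLT K M →ₗ[K] MvPolynomial (Fin 3) K) := fun q =>
    (LinearMap.mulRight K (Λ q)) ∘ₗ (Polynomial.aeval (X 0)).toLinearMap ∘ₗ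
      (Polynomial.degreeLT K M).subtype
  have hψ : ∀ q f, ψ q f = Polynomial.aeval (X 0) (f : Polynomial K) * Λ q :=
    fun q f => rfl
  let Φ₀ : V →ₗ[K] MvPolynomial (Fin 3) K :=
    LinearMap.coprod (∑ q, ψ q ∘ₗ LinearMap.proj q)
      (LinearMap.coprod (LinearMap.mulLeft K G ∘ₗ Submodule.subtype _)
        (LinearMap.mulLeft K H ∘ₗ Submodule.subtype _))
  have hΦ₀ : ∀ v : V, Φ₀ v = ∑ q, ψ q (v.1 q) + (G * v.2.1 + H * v.2.2) := by
    intro v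
    change (∑ q, ψ q ∘ₗ LinearMap.proj q) v.1 + _ = _
    rw [LinearMap.sum_apply]
    rfl
  have hmem : ∀ v, Φ₀ v ∈ restrictTotalDegree (Fin 3) K (a + d + e) := by
    intro v
    rw [hΦ₀]
    refine Submodule.add_mem _ (Submodule.sum_mem _ fun q _ => ?_) (Submodule.add_mem _ ?_ ?_)
    · rw [hψ, mem_restrictTotalDegree]
      by_cases h0 : (v.1 q : Polynomial K) = 0
      · simp [h0]
      have h1 : (v.1 q : Polynomial K).natDegree < M :=
        (Polynomial.natDegree_lt_iff_degree_lt h0).mpr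
          (Polynomial.mem_degreeLT.mp (v.1 q).2)
      have h2 := totalDegree_aeval_X_le (v.1 q : Polynomial K) 0
      have h3 := (hΛ q).1
      refine (totalDegree_mul _ _).trans ?_
      omega
    · rw [mem_restrictTotalDegree]
      have := (mem_restrictTotalDegree _ _ _).mp v.2.1.2
      refine (totalDegree_mul _ _).trans ?_
      omega
    · rw [mem_restrictTotalDegree]
      have := (mem_restrictTotalDegree _ _ _).mp v.2.2.2
      refine (totalDegree_mul _ _).trans ?_
      omega
  let Φ : V →ₗ[K] restrictTotalDegree (Fin 3) K (a + d + e) := Φ₀.codRestrict _ hmem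
  have hT : ∀ c : restrictTotalDegree (Fin 3) K a,
      (H * c : MvPolynomial (Fin 3) K) ∈ restrictTotalDegree (Fin 3) K (a + e) ∧
      (-(G * c) : MvPolynomial (Fin 3) K) ∈ restrictTotalDegree (Fin 3) K (a + d) := by
    intro c
    have hc := (mem_restrictTotalDegree _ _ _).mp c.2
    constructor
    · rw [mem_restrictTotalDegree]
      refine (totalDegree_mul _ _).trans ?_
      omega
    · rw [mem_restrictTotalDegree, totalDegree_neg]
      refine (totalDegree_mul _ _).trans ?_
      omega
  let T : restrictTotalDegree (Fin 3) K a →ₗ[K] V :=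
    LinearMap.prod 0 (LinearMap.prod
      ((LinearMap.mulLeft K H ∘ₗ Submodule.subtype _).codRestrict _ fun c => (hT c).1)
      ((-(LinearMap.mulLeft K G ∘ₗ Submodule.subtype _)).codRestrict _ fun c => (hT c).2))
  have hker : LinearMap.ker Φ ≤ LinearMap.range T := by
    intro v hv
    have hv0 : ∑ q, ψ q (v.1 q) + (G * v.2.1 + H * v.2.2) = 0 := by
      rw [← hΦ₀]
      exact congrArg Subtype.val (LinearMap.mem_ker.mp hv)
    have hv1 : v.1 = 0 := by
      funext q
      have h1 := congrArg (lineRestrict q.1) hv0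
      rw [map_add, map_add, map_mul, map_mul, hSG q q.2, hSH q q.2, zero_mul, zero_mul, add_zero,
        add_zero, map_zero, map_sum, sum_eq_single q] at h1
      · rw [hψ, map_mul, lineRestrict_aeval_X] at h1
        exact Subtype.ext ((mul_eq_zero.mp h1).resolve_right (hΛ q).2.1)
      · intro r _ hrq
        rw [hψ, map_mul, (hΛ r).2.2 q q.2 (fun h => hrq (Subtype.ext h.symm)), mul_zero]
      · simp
    have hv2 : G * (v.2.1 : MvPolynomial (Fin 3) K) + H * v.2.2 = 0 := by
      simpa [hv1] using hv0
    have hdvd : G ∣ H * v.2.2 := ⟨-v.2.1, by linear_combination hv2⟩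
    obtain ⟨c, hc⟩ := (hG.dvd_or_dvd hdvd).resolve_left hGH
    have h21 : (v.2.1 : MvPolynomial (Fin 3) K) = -(H * c) := by
      apply mul_left_cancel₀ hG0
      rw [hc] at hv2
      linear_combination hv2
    have hca : (-c) ∈ restrictTotalDegree (Fin 3) K a := by
      rw [mem_restrictTotalDegree, totalDegree_neg]
      by_cases hc0 : c = 0
      · simp [hc0]
      have h3 := (mem_restrictTotalDegree _ _ _).mp v.2.1.2
      rw [h21, totalDegree_neg, totalDegree_mul_of_isDomain hH0 hc0] at h3
      omega
    refine ⟨⟨-c, hca⟩, ?_⟩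
    refine Prod.ext hv1.symm (Prod.ext (Subtype.ext ?_) (Subtype.ext ?_))
    · change H * (-c) = _
      rw [h21]
      ring
    · change -(G * (-c)) = _
      rw [hc]
      ring
  have h1 := LinearMap.finrank_range_add_finrank_ker Φ
  have h2 : Module.finrank K (LinearMap.range Φ) ≤ (a + d + e + 3).choose 3 := by
    rw [← finrank_restrictTotalDegree (K := K)]
    exact Submodule.finrank_le _
  have h3 : Module.finrank K (LinearMap.ker Φ) ≤ (a + 3).choose 3 := by
    rw [← finrank_restrictTotalDegree (K := K)]
    exact (Submodule.finrank_mono hker).trans (LinearMap.finrank_range_le T)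
  have h4 : Module.finrank K V =
      #S * M + ((a + e + 3).choose 3 + (a + d + 3).choose 3) := by
    have : Module.finrank K (Polynomial.degreeLT K M) = M := by
      rw [(Polynomial.degreeLTEquiv K M).finrank_eq]
      simp
    simp only [V]
    rw [Module.finrank_prod, Module.finrank_prod, finrank_restrictTotalDegree,
      finrank_restrictTotalDegree, Module.finrank_pi_fintype]
    simp [this]
  omega

lemma six_mul_choose_three (m : ℕ) :
    6 * (m + 3).choose 3 = (m + 1) * (m + 2) * (m + 3) := by
  induction m with
  | zero => rfl
  | succ m ih =>
    have h2 : 2 * (m + 3).choose 2 = (m + 3) * (m + 2) := by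
      rw [Nat.choose_two_right, show m + 3 - 1 = m + 2 by omega]
      exact Nat.mul_div_cancel' (Nat.even_mul_pred_self (m + 3)).two_dvd
    rw [show m + 1 + 3 = (m + 3) + 1 by omega, Nat.choose_succ_succ' (m + 3) 2]
    nlinarith

/-- Two surfaces without common component, one of them irreducible, share at most as many lines
as the product of their degrees. -/
lemma card_common_lines_le {G H : MvPolynomial (Fin 3) K} (hG : Prime G) (hGH : ¬ G ∣ H)
    (S : Finset (K × K × K)) (hSG : ∀ q ∈ S, lineRestrict q G = 0)
    (hSH : ∀ q ∈ S, lineRestrict q H = 0) :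
    #S ≤ G.totalDegree * H.totalDegree := by
  by_contra! hlt
  set d := G.totalDegree with hd
  set e := H.totalDegree with he
  set N := #S with hN
  have hk := card_mul_add_choose_le hG hGH S hSG hSH (d * e * (N + 2) + d + e + 1)
    (d * e * (N + 2) + 1 + N) (by omega)
  rw [← hd, ← he, ← hN] at hk
  set a := d * e * (N + 2) + 1 + N with ha
  have e1 := six_mul_choose_three (a + e)
  have e2 := six_mul_choose_three (a + d)
  have e3 := six_mul_choose_three (a + d + e)
  have e4 := six_mul_choose_three a
  have h5 : 6 * (N * (d * e * (N + 2) + d + e + 1)) ≤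
      d * e * (6 * a + 12 + 3 * d + 3 * e) := by
    zify at *
    nlinarith
  have h6 : (d * e + 1) * (d * e * (N + 2) + d + e + 1) ≤
    N * (d * e * (N + 2) + d + e + 1) := Nat.mul_le_mul_right _ hlt
  rw [ha] at h5
  have h7 : 6 * ((d * e + 1) * (d * e * (N + 2) + d + e + 1)) ≤
      d * e * (6 * (d * e * (N + 2) + 1 + N) + 12 + 3 * d + 3 * e) := by omega
  generalize d * e = f at h7
  nlinarith [Nat.zero_le (f * d), Nat.zero_le (f * e), Nat.zero_le (f * N)]

end Bezout

section Interpolation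

open MvPolynomial

variable {K : Type*} [Field K]

lemma exists_vanishing_of_card_lt (S : Finset (K × K × K)) (d : ℕ)
    (h : 6 * #S < (d + 2) * (d + 3)) :
    ∃ F : MvPolynomial (Fin 3) K, F ≠ 0 ∧ F.totalDegree ≤ d ∧ ∀ q ∈ S, lineRestrict q F = 0 := by
  let Φ : restrictTotalDegree (Fin 3) K d →ₗ[K] (S → Fin (d + 1) → K) :=
    LinearMap.pi fun q => LinearMap.pi fun i => Polynomial.lcoeff K i ∘ₗ
      (lineRestrict q.1).toLinearMap ∘ₗ Submodule.subtype _
  have hfin : Module.finrank K (S → Fin (d + 1) → K) <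
      Module.finrank K (restrictTotalDegree (Fin 3) K d) := by
    rw [finrank_restrictTotalDegree, Module.finrank_pi_fintype]
    have := six_mul_choose_three d
    simp only [Module.finrank_fin_fun, sum_const, card_univ, Fintype.card_coe, smul_eq_mul]
    nlinarith
  have : Module.Finite K (restrictTotalDegree (Fin 3) K d) :=
    Module.finite_of_finrank_pos (by omega)
  obtain ⟨F, hF, hF0⟩ := (Submodule.ne_bot_iff _).mp (Φ.ker_ne_bot_of_finrank_lt hfin)
  have hd := (mem_restrictTotalDegree _ _ _).mp F.2
  refine ⟨F, fun h0 => hF0 (Subtype.ext h0), hd, fun q hq => ?_⟩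
  ext i
  rw [Polynomial.coeff_zero]
  by_cases hi : i < d + 1
  · exact congrFun (congrFun (LinearMap.mem_ker.mp hF) ⟨q, hq⟩) ⟨i, hi⟩
  · exact Polynomial.coeff_eq_zero_of_natDegree_lt
      (((natDegree_lineRestrict_le q _).trans hd).trans_lt (by omega))

/-- A family of `N` lines lies on a surface of degree at most `√(6N)`. -/
lemma exists_vanishing (S : Finset (K × K × K)) :
    ∃ F : MvPolynomial (Fin 3) K, F ≠ 0 ∧ F.totalDegree ^ 2 ≤ 6 * #S ∧
      ∀ q ∈ S, lineRestrict q F = 0 := by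
  obtain ⟨F, h0, hd, hF⟩ := exists_vanishing_of_card_lt S (Nat.sqrt (6 * #S)) (by
    have := Nat.lt_succ_sqrt (6 * #S)
    nlinarith)
  refine ⟨F, h0, ?_, hF⟩
  have := Nat.sqrt_le' (6 * #S)
  exact (Nat.pow_le_pow_left hd 2).trans this

end Interpolation

section Differential

open MvPolynomial

variable {K : Type*} [Field K]

lemma derivative_lineRestrict (q : K × K × K) (G : MvPolynomial (Fin 3) K) :
    Polynomial.derivative (lineRestrict q G) = lineRestrict q
      (pderiv 0 G + C q.1 * pderiv 1 G + C (q.1 ^ 2) * pderiv 2 G) := by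
  induction G using MvPolynomial.induction_on with
  | C a => simp [lineRestrict]
  | add p r hp hr =>
    simp only [map_add, hp, hr, map_mul]
    ring
  | mul_X p i hp =>
    rw [map_mul, Polynomial.derivative_mul, hp]
    simp only [pderiv_mul, map_add, map_mul]
    fin_cases i <;> simp [lineRestrict, pderiv_X, Polynomial.derivative_pow] <;> ring

lemma pderiv_comm {R σ : Type*} [CommSemiring R] (i j : σ) (G : MvPolynomial σ R) :
    pderiv i (pderiv j G) = pderiv j (pderiv i G) := by
  classical
  ext m
  simp only [coeff_pderiv]
  by_cases h : i = j
  · rw [h]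
  · rw [add_right_comm]
    simp only [Finsupp.add_apply, Finsupp.single_apply, h, Ne.symm h, if_false, add_zero]
    ring

lemma totalDegree_pderiv_le {R σ : Type*} [CommSemiring R] (i : σ) (G : MvPolynomial σ R) :
    (pderiv i G).totalDegree ≤ G.totalDegree - 1 := by
  classical
  refine Finset.sup_le fun m hm => ?_
  rw [mem_support_iff, coeff_pderiv] at hm
  have h : m + Finsupp.single i 1 ∈ G.support := by
    rw [mem_support_iff]
    exact left_ne_zero_of_mul hm
  have h2 := le_totalDegree h
  rw [Finsupp.sum_add_index' (by simp) (by simp)] at h2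
  simp at h2
  change m.sum (fun _ e => e) ≤ _
  omega

/-- A polynomial of degree less than the characteristic with vanishing gradient is constant. -/
lemma totalDegree_eq_zero_of_pderiv (p : ℕ) [CharP K p] {σ : Type*} {G : MvPolynomial σ K}
    (hG : G.totalDegree < p) (h : ∀ i, pderiv i G = 0) : G.totalDegree = 0 := by
  classical
  rw [totalDegree_eq_zero_iff]
  intro m hm i
  by_contra hi
  have h1 := coeff_pderiv (i := i) G (m - Finsupp.single i 1)
  have h2 : m - Finsupp.single i 1 + Finsupp.single i 1 = m := by
    apply tsub_add_cancel_of_le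
    rw [Finsupp.single_le_iff]
    omega
  have h3 : (m - Finsupp.single i 1 : σ →₀ ℕ) i + 1 = m i := by
    simp
    omega
  rw [h, coeff_zero, h2, eq_comm, mul_eq_zero, ← Nat.cast_add_one, h3] at h1
  rcases h1 with h1 | h1
  · exact mem_support_iff.mp hm h1
  · rw [CharP.cast_eq_zero_iff K p] at h1
    have h4 := Nat.le_of_dvd (by omega) h1
    have h5 := le_totalDegree hm
    have h6 : m i ≤ m.sum fun _ e => e := by
      rw [Finsupp.sum]
      exact single_le_sum (f := fun i => m i) (fun _ _ => Nat.zero_le _)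
        (Finsupp.mem_support_iff.mpr hi)
    omega

lemma eq_zero_of_derivative_relation (p : ℕ) [CharP K p] {f g q h : Polynomial K} {a : K}
    (hrel : g * Polynomial.derivative (Polynomial.derivative f) =
      q * Polynomial.derivative f + h * f)
    (hf : f.eval a = 0) (hf' : (Polynomial.derivative f).eval a = 0) (hg : g.eval a ≠ 0)
    (hdeg : f.natDegree < p) : f = 0 := by
  by_contra hf0
  obtain ⟨k, hk, hka⟩ := f.exists_eq_pow_rootMultiplicity_mul_and_not_dvd hf0 a
  rw [Polynomial.dvd_iff_isRoot, Polynomial.IsRoot] at hka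
  have hm : f.rootMultiplicity a < p := by
    have h1 := Polynomial.natDegree_mul (pow_ne_zero (f.rootMultiplicity a)
      (Polynomial.X_sub_C_ne_zero a)) (q := k) (fun h => hka (by simp [h]))
    rw [← hk, Polynomial.natDegree_pow, Polynomial.natDegree_X_sub_C] at h1
    omega
  generalize f.rootMultiplicity a = m at hm hk
  subst hk
  obtain _ | _ | n := m
  · simp [hka] at hf
  · simp [hka] at hf'
  · clear hf hf'
    have hd : ∀ (j : ℕ) (u : Polynomial K),
        Polynomial.derivative ((Polynomial.X - Polynomial.C a) ^ (j + 1) * u) =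
          (Polynomial.X - Polynomial.C a) ^ j * (((j : Polynomial K) + 1) * u +
            (Polynomial.X - Polynomial.C a) * Polynomial.derivative u) := by
      intro j u
      rw [Polynomial.derivative_mul, Polynomial.derivative_X_sub_C_pow]
      rw [Polynomial.C_eq_natCast, Nat.add_sub_cancel]
      push_cast
      ring
    have hd2 : Polynomial.derivative (((n + 1 : ℕ) + 1 : Polynomial K) * k +
        (Polynomial.X - Polynomial.C a) * Polynomial.derivative k) =
        (n + 3 : Polynomial K) * Polynomial.derivative k +
          (Polynomial.X - Polynomial.C a) * Polynomial.derivative (Polynomial.derivative k) := by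
      simp [Polynomial.derivative_mul]
      ring
    rw [hd, hd, hd2] at hrel
    clear hd hd2
    generalize Polynomial.derivative (Polynomial.derivative k) = k2 at hrel
    generalize Polynomial.derivative k = k1 at hrel
    have e : (Polynomial.X - Polynomial.C a) ^ n *
        (g * (((n : Polynomial K) + 1) * ((n : Polynomial K) + 2) * k)) =
        (Polynomial.X - Polynomial.C a) ^ n * ((Polynomial.X - Polynomial.C a) *
        (q * (((n : Polynomial K) + 2) * k + (Polynomial.X - Polynomial.C a) * k1) +
          h * (Polynomial.X - Polynomial.C a) * k -
          g * (2 * ((n : Polynomial K) + 2) * k1 + (Polynomial.X - Polynomial.C a) * k2))) := by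
      generalize Polynomial.X - Polynomial.C a = y at hrel ⊢
      push_cast at hrel
      linear_combination hrel
    have e2 := congrArg (Polynomial.eval a)
      (mul_left_cancel₀ (pow_ne_zero n (Polynomial.X_sub_C_ne_zero a)) e)
    simp [hka, hg] at e2
    have e3 : ((n + 1 : ℕ) : K) = 0 ∨ ((n + 2 : ℕ) : K) = 0 := by
      push_cast
      exact e2
    simp only [CharP.cast_eq_zero_iff K p] at e3
    rcases e3 with h1 | h1 <;> have := Nat.le_of_dvd (by omega) h1 <;> omega

end Differential

section Flecnode

open MvPolynomial

variable {K : Type*} [Field K]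

/-- The derivative of `G` in the direction `(1, t, t²)`. -/
noncomputable def dirDeriv (t : K) (G : MvPolynomial (Fin 3) K) : MvPolynomial (Fin 3) K :=
  pderiv 0 G + C t * pderiv 1 G + C (t ^ 2) * pderiv 2 G

lemma eval_dirDeriv (P : Fin 3 → K) (t : K) (G : MvPolynomial (Fin 3) K) :
    eval P (dirDeriv t G) =
      eval P (pderiv 0 G) + t * eval P (pderiv 1 G) + t ^ 2 * eval P (pderiv 2 G) := by
  simp [dirDeriv]

/-- Let `c₀ + c₁ t + c₂ t²` and `n₀ + ⋯ + n₄ t⁴` be the first and second derivative of `G` in the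
direction `(1, t, t²)`. The remainder of `c₂³ (n₀ + ⋯ + n₄ t⁴)` modulo `c₀ + c₁ t + c₂ t²`
is `flecLin G * t + flecConst G`. -/
noncomputable def flecLin (G : MvPolynomial (Fin 3) K) : MvPolynomial (Fin 3) K :=
  pderiv 2 (pderiv 2 G) * (pderiv 0 G * pderiv 1 G * pderiv 2 G + pderiv 0 G * pderiv 1 G *
      pderiv 2 G - pderiv 1 G * pderiv 1 G * pderiv 1 G) +
    (pderiv 1 (pderiv 2 G) + pderiv 1 (pderiv 2 G)) * (pderiv 1 G * pderiv 1 G * pderiv 2 G -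
      pderiv 0 G * pderiv 2 G * pderiv 2 G) -
    (pderiv 1 (pderiv 1 G) + (pderiv 0 (pderiv 2 G) + pderiv 0 (pderiv 2 G))) *
      (pderiv 1 G * pderiv 2 G * pderiv 2 G) +
    (pderiv 0 (pderiv 1 G) + pderiv 0 (pderiv 1 G)) * (pderiv 2 G * pderiv 2 G * pderiv 2 G)

/-- The constant coefficient of the remainder described in the documentation of `flecLin`. -/
noncomputable def flecConst (G : MvPolynomial (Fin 3) K) : MvPolynomial (Fin 3) K :=
  pderiv 2 (pderiv 2 G) * (pderiv 0 G * pderiv 0 G * pderiv 2 G -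
      pderiv 0 G * pderiv 1 G * pderiv 1 G) +
    (pderiv 1 (pderiv 2 G) + pderiv 1 (pderiv 2 G)) * (pderiv 0 G * pderiv 1 G * pderiv 2 G) -
    (pderiv 1 (pderiv 1 G) + (pderiv 0 (pderiv 2 G) + pderiv 0 (pderiv 2 G))) *
      (pderiv 0 G * pderiv 2 G * pderiv 2 G) +
    pderiv 0 (pderiv 0 G) * (pderiv 2 G * pderiv 2 G * pderiv 2 G)

lemma exists_flec_identity (G : MvPolynomial (Fin 3) K) (t : K) :
    ∃ q, pderiv 2 G ^ 3 * dirDeriv t (dirDeriv t G) =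
      q * dirDeriv t G + (C t * flecLin G + flecConst G) := by
  refine ⟨pderiv 2 (pderiv 2 G) * pderiv 2 G ^ 2 * C t ^ 2 +
    (2 * pderiv 1 (pderiv 2 G) * pderiv 2 G ^ 2 -
      pderiv 2 (pderiv 2 G) * pderiv 1 G * pderiv 2 G) * C t +
    ((pderiv 1 (pderiv 1 G) + 2 * pderiv 0 (pderiv 2 G)) * pderiv 2 G ^ 2 -
      2 * pderiv 1 (pderiv 2 G) * pderiv 1 G * pderiv 2 G +
      pderiv 2 (pderiv 2 G) * (pderiv 1 G ^ 2 - pderiv 0 G * pderiv 2 G)), ?_⟩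
  simp only [dirDeriv, flecLin, flecConst, map_add, pderiv_C_mul, C_pow,
    pderiv_comm 1 0 G, pderiv_comm 2 0 G, pderiv_comm 2 1 G]
  have : ∀ i (j : Fin 3), pderiv i (C t ^ 2 * pderiv j G) = C t ^ 2 * pderiv i (pderiv j G) := by
    intro i j
    rw [← C_pow, pderiv_C_mul]
  simp only [this]
  ring

lemma totalDegree_flec_le (G : MvPolynomial (Fin 3) K) :
    (flecLin G).totalDegree ≤ 4 * G.totalDegree ∧
      (flecConst G).totalDegree ≤ 4 * G.totalDegree := by
  have h1 : ∀ i, (pderiv i G).totalDegree ≤ G.totalDegree := fun i =>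
    (totalDegree_pderiv_le i G).trans (Nat.sub_le _ _)
  have h2 : ∀ i j, (pderiv i (pderiv j G)).totalDegree ≤ G.totalDegree := fun i j =>
    ((totalDegree_pderiv_le i _).trans (Nat.sub_le _ _)).trans (h1 j)
  have hadd : ∀ (f g : MvPolynomial (Fin 3) K) (m : ℕ), f.totalDegree ≤ m → g.totalDegree ≤ m →
    (f + g).totalDegree ≤ m := fun f g m hf hg => (totalDegree_add f g).trans (max_le hf hg)
  have hsub : ∀ (f g : MvPolynomial (Fin 3) K) (m : ℕ), f.totalDegree ≤ m → g.totalDegree ≤ m →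
    (f - g).totalDegree ≤ m := fun f g m hf hg => (totalDegree_sub f g).trans (max_le hf hg)
  have hmul : ∀ f g : MvPolynomial (Fin 3) K, f.totalDegree ≤ G.totalDegree →
      g.totalDegree ≤ 3 * G.totalDegree → (f * g).totalDegree ≤ 4 * G.totalDegree :=
    fun f g hf hg => (totalDegree_mul f g).trans (by omega)
  have h3 : ∀ i j k, (pderiv i G * pderiv j G * pderiv k G).totalDegree ≤ 3 * G.totalDegree := by
    intro i j k
    have e1 := totalDegree_mul (pderiv i G * pderiv j G) (pderiv k G)
    have e2 := totalDegree_mul (pderiv i G) (pderiv j G)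
    have := h1 i
    have := h1 j
    have := h1 k
    omega
  unfold flecLin flecConst
  constructor <;>
    repeat' first
      | with_reducible exact h3 _ _ _
      | with_reducible exact h2 _ _
      | with_reducible refine hmul _ _ ?_ ?_
      | with_reducible refine hadd _ _ _ ?_ ?_
      | with_reducible refine hsub _ _ _ ?_ ?_

lemma lineRestrict_dirDeriv {q : K × K × K} {G : MvPolynomial (Fin 3) K} :
    lineRestrict q (dirDeriv q.1 G) = Polynomial.derivative (lineRestrict q G) :=
  (derivative_lineRestrict q G).symm

/-- The line through `P` in the direction `(1, t, t²)`. -/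
def lineThrough (P : Fin 3 → K) (t : K) : K × K × K := (t, P 1 - t * P 0, P 2 - t * P 1)

lemma linePt_lineThrough (P : Fin 3 → K) (t : K) : linePt (lineThrough P t) (P 0) = P := by
  funext i
  fin_cases i <;> simp [linePt, lineThrough]
  ring

lemma lineThrough_linePt (q : K × K × K) (x : K) : lineThrough (linePt q x) q.1 = q := by
  refine Prod.ext rfl (Prod.ext ?_ ?_) <;> simp [linePt, lineThrough]
  ring

lemma lineRestrict_lineThrough_eq_zero (p : ℕ) [CharP K p] {G : MvPolynomial (Fin 3) K}
    (hlin : G ∣ flecLin G) (hconst : G ∣ flecConst G) (hdeg : G.totalDegree < p)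
    {P : Fin 3 → K} {t : K} (hP : eval P G = 0) (hQ : eval P (dirDeriv t G) = 0)
    (hc : eval P (pderiv 2 G) ≠ 0) : lineRestrict (lineThrough P t) G = 0 := by
  obtain ⟨q, hq⟩ := exists_flec_identity G t
  obtain ⟨h1, hh1⟩ := hlin
  obtain ⟨h2, hh2⟩ := hconst
  have hrel := congrArg (lineRestrict (lineThrough P t)) hq
  rw [hh1, hh2, show C t * (G * h1) + G * h2 = (C t * h1 + h2) * G by ring] at hrel
  simp only [map_mul _ (_ ^ 3), map_add _ (_ * dirDeriv t G), map_mul _ q, map_mul _ _ G] at hrel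
  have hd : ∀ F, lineRestrict (lineThrough P t) (dirDeriv t F) =
      Polynomial.derivative (lineRestrict (lineThrough P t) F) := fun F =>
    lineRestrict_dirDeriv (q := lineThrough P t)
  rw [hd, hd] at hrel
  refine eq_zero_of_derivative_relation p (a := P 0) hrel ?_ ?_ ?_
    ((natDegree_lineRestrict_le _ _).trans_lt hdeg)
  · rw [eval_lineRestrict, linePt_lineThrough, hP]
  · rw [← hd, eval_lineRestrict, linePt_lineThrough, hQ]
  · rw [eval_lineRestrict, linePt_lineThrough, map_pow]
    exact pow_ne_zero _ hc

/-- At the intersection of two lines in the surface `G = 0`, both coefficients of the remainder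
vanish. -/
lemma eval_flec_eq_zero {q m : K × K × K} {G : MvPolynomial (Fin 3) K}
    (hq : lineRestrict q G = 0) (hm : lineRestrict m G = 0) (hqm : q.1 ≠ m.1) {x : K}
    (hx : linePt q x = linePt m x) :
    eval (linePt q x) (flecLin G) = 0 ∧ eval (linePt q x) (flecConst G) = 0 := by
  have key : ∀ r : K × K × K, lineRestrict r G = 0 → linePt q x = linePt r x →
      r.1 * eval (linePt q x) (flecLin G) + eval (linePt q x) (flecConst G) = 0 := by
    intro r hr hrx
    obtain ⟨g, hg⟩ := exists_flec_identity G r.1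
    have h1 : lineRestrict r (dirDeriv r.1 G) = 0 := by
      rw [lineRestrict_dirDeriv, hr, Polynomial.derivative_zero]
    have h2 : lineRestrict r (dirDeriv r.1 (dirDeriv r.1 G)) = 0 := by
      rw [lineRestrict_dirDeriv, h1, Polynomial.derivative_zero]
    have h3 := congrArg (eval (linePt r x)) hg
    rw [map_mul, eval_linePt_of_lineRestrict h2, map_add, map_mul,
      eval_linePt_of_lineRestrict h1] at h3
    rw [hrx]
    simpa using h3.symm
  have h1 := key q hq rfl
  have h2 := key m hm hx
  have h3 : eval (linePt q x) (flecLin G) = 0 := by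
    have : (q.1 - m.1) * eval (linePt q x) (flecLin G) = 0 := by linear_combination h1 - h2
    exact (mul_eq_zero.mp this).resolve_left (sub_ne_zero.mpr hqm)
  exact ⟨h3, by simpa [h3] using h1⟩

end Flecnode

section Config

open MvPolynomial

variable {K : Type*} [Field K]

/-- Two lines `q` and `r` of different direction meet if and only if `LineAdj q r`. -/
def LineAdj (q r : K × K × K) : Prop := q.2.2 - r.2.2 + q.1 * r.2.1 - r.1 * q.2.1 = 0

instance [DecidableEq K] : DecidableRel (LineAdj (K := K)) :=
  fun _ _ => inferInstanceAs (Decidable (_ = _))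

lemma LineAdj.symm {q r : K × K × K} (h : LineAdj q r) : LineAdj r q := by
  unfold LineAdj at *
  linear_combination -h

lemma lineAdj_comm {q r : K × K × K} : LineAdj q r ↔ LineAdj r q := ⟨.symm, .symm⟩

lemma linePt_eq_iff {q r : K × K × K} {x : K} : linePt q x = linePt r x ↔
    q.2.1 + q.1 * x = r.2.1 + r.1 * x ∧
      q.2.2 + q.1 * q.2.1 + q.1 ^ 2 * x = r.2.2 + r.1 * r.2.1 + r.1 ^ 2 * x := by
  simp [linePt]

lemma lineAdj_of_linePt_eq {q r : K × K × K} {x : K} (h : linePt q x = linePt r x) :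
    LineAdj q r := by
  rw [linePt_eq_iff] at h
  unfold LineAdj
  linear_combination h.2 - (q.1 + r.1) * h.1

lemma LineAdj.exists_linePt_eq {q r : K × K × K} (h : LineAdj q r) (hqr : q.1 ≠ r.1) :
    ∃ x, linePt q x = linePt r x := by
  have h0 : q.1 - r.1 ≠ 0 := sub_ne_zero.mpr hqr
  refine ⟨(r.2.1 - q.2.1) / (q.1 - r.1), ?_⟩
  rw [linePt_eq_iff]
  unfold LineAdj at h
  constructor
  · field_simp
    ring
  · field_simp
    linear_combination (q.1 - r.1) * h

lemma eval_dirDeriv_eq_zero {q : K × K × K} {G : MvPolynomial (Fin 3) K}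
    (h : lineRestrict q G = 0) (x : K) : eval (linePt q x) (dirDeriv q.1 G) = 0 := by
  rw [← eval_lineRestrict, lineRestrict_dirDeriv, h, Polynomial.derivative_zero,
    Polynomial.eval_zero]

lemma eq_zero_of_dvd_of_totalDegree_lt {G F : MvPolynomial (Fin 3) K} (hGF : G ∣ F)
    (h : F.totalDegree < G.totalDegree) : F = 0 := by
  by_contra hF
  obtain ⟨c, rfl⟩ := hGF
  rw [totalDegree_mul_of_isDomain (left_ne_zero_of_mul hF) (right_ne_zero_of_mul hF)] at h
  omega

lemma totalDegree_pos_of_lineRestrict {q : K × K × K} {G : MvPolynomial (Fin 3) K}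
    (hG : G ≠ 0) (h : lineRestrict q G = 0) : 0 < G.totalDegree := by
  rw [pos_iff_ne_zero]
  intro h0
  rw [totalDegree_eq_zero_iff_eq_C] at h0
  rw [h0] at h hG
  simp only [lineRestrict, algHom_C] at h
  refine hG ?_
  rw [(map_eq_zero _).mp h, C_0]

variable [DecidableEq K]

/-- Two families of lines such that lines of the same family are disjoint, lines of different
families have different directions, and any two lines of one family are met by at most `κ` common
lines of the other one. -/
structure LineConfig (κ : ℕ) (R B : Finset (K × K × K)) : Prop where
  sep_left : ∀ q ∈ R, ∀ r ∈ R, LineAdj q r → q = r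
  sep_right : ∀ q ∈ B, ∀ r ∈ B, LineAdj q r → q = r
  dir : ∀ q ∈ R, ∀ r ∈ B, q.1 ≠ r.1
  codeg_left : ∀ q ∈ R, ∀ r ∈ R, q ≠ r → #{m ∈ B | LineAdj q m ∧ LineAdj r m} ≤ κ
  codeg_right : ∀ q ∈ B, ∀ r ∈ B, q ≠ r → #{m ∈ R | LineAdj q m ∧ LineAdj r m} ≤ κ

variable {κ : ℕ} {R B : Finset (K × K × K)}

lemma LineConfig.symm (h : LineConfig κ R B) : LineConfig κ B R :=
  ⟨h.sep_right, h.sep_left, fun q hq r hr => (h.dir r hr q hq).symm, h.codeg_right, h.codeg_left⟩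

lemma LineConfig.mono (h : LineConfig κ R B) {R' B' : Finset (K × K × K)} (hR : R' ⊆ R)
    (hB : B' ⊆ B) : LineConfig κ R' B' :=
  ⟨fun q hq r hr => h.sep_left q (hR hq) r (hR hr),
    fun q hq r hr => h.sep_right q (hB hq) r (hB hr),
    fun q hq r hr => h.dir q (hR hq) r (hB hr),
    fun q hq r hr hqr => (card_le_card (filter_subset_filter _ hB)).trans
      (h.codeg_left q (hR hq) r (hR hr) hqr),
    fun q hq r hr hqr => (card_le_card (filter_subset_filter _ hR)).trans
      (h.codeg_right q (hB hq) r (hB hr) hqr)⟩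

lemma LineConfig.disjoint (h : LineConfig κ R B) : Disjoint R B :=
  disjoint_left.mpr fun q hq hq' => h.dir q hq q hq' rfl

/-- A polynomial vanishing at more intersection points of `q` with disjoint lines than its degree
vanishes on `q`. -/
lemma lineRestrict_eq_zero_of_meets {q : K × K × K} {M : Finset (K × K × K)}
    (hadj : ∀ m ∈ M, LineAdj q m) (hdir : ∀ m ∈ M, q.1 ≠ m.1)
    (hsep : ∀ m ∈ M, ∀ r ∈ M, LineAdj m r → m = r) {F : MvPolynomial (Fin 3) K}
    (hF : ∀ m ∈ M, ∀ x, linePt q x = linePt m x → eval (linePt q x) F = 0)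
    (hcard : F.totalDegree < #M) : lineRestrict q F = 0 := by
  choose! f hf using fun m (hm : m ∈ M) => (hadj m hm).exists_linePt_eq (hdir m hm)
  refine lineRestrict_eq_zero_of_card (M.image f) ?_ ?_
  · intro x hx
    obtain ⟨m, hm, rfl⟩ := mem_image.mp hx
    exact hF m hm _ (hf m hm)
  · rwa [card_image_of_injOn]
    intro m hm r hr hmr
    refine hsep m hm r hr (lineAdj_of_linePt_eq (x := f m) ?_)
    rw [← hf m hm]
    have := hf r hr
    rwa [← hmr] at this

lemma LineConfig.dvd_of_meets (h : LineConfig κ R B) {G F : MvPolynomial (Fin 3) K}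
    (hG : Prime G) (hR : ∀ q ∈ R, lineRestrict q G = 0) (hB : ∀ q ∈ B, lineRestrict q G = 0)
    (hdR : ∀ q ∈ R, F.totalDegree < #{m ∈ B | LineAdj q m})
    (hdB : ∀ q ∈ B, F.totalDegree < #{m ∈ R | LineAdj q m})
    (hF : ∀ q ∈ R, ∀ m ∈ B, ∀ x, linePt q x = linePt m x → eval (linePt q x) F = 0)
    (hcard : G.totalDegree * F.totalDegree < #R + #B) : G ∣ F := by
  by_contra hGF
  rw [← card_union_of_disjoint h.disjoint] at hcard
  refine hcard.not_ge (card_common_lines_le hG hGF _ ?_ ?_)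
  · intro q hq
    exact (mem_union.mp hq).elim (hR q) (hB q)
  · intro q hq
    rcases mem_union.mp hq with hq | hq
    · refine lineRestrict_eq_zero_of_meets (M := {m ∈ B | LineAdj q m}) ?_ ?_ ?_ ?_ (hdR q hq)
      · exact fun m hm => (mem_filter.mp hm).2
      · exact fun m hm => h.dir q hq m (mem_filter.mp hm).1
      · exact fun m hm r hr => h.sep_right m (mem_filter.mp hm).1 r (mem_filter.mp hr).1
      · exact fun m hm => hF q hq m (mem_filter.mp hm).1
    · refine lineRestrict_eq_zero_of_meets (M := {m ∈ R | LineAdj q m}) ?_ ?_ ?_ ?_ (hdB q hq)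
      · exact fun m hm => (mem_filter.mp hm).2
      · exact fun m hm => (h.dir m (mem_filter.mp hm).1 q hq).symm
      · exact fun m hm r hr => h.sep_left m (mem_filter.mp hm).1 r (mem_filter.mp hr).1
      · intro m hm x hx
        rw [hx]
        exact hF m (mem_filter.mp hm).1 q hq x hx.symm

lemma LineConfig.dvd_flec (h : LineConfig κ R B) {G : MvPolynomial (Fin 3) K}
    (hG : Prime G) (hR : ∀ q ∈ R, lineRestrict q G = 0) (hB : ∀ q ∈ B, lineRestrict q G = 0)
    (hdR : ∀ q ∈ R, 4 * G.totalDegree < #{m ∈ B | LineAdj q m})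
    (hdB : ∀ q ∈ B, 4 * G.totalDegree < #{m ∈ R | LineAdj q m})
    (hcard : 4 * G.totalDegree ^ 2 < #R + #B) : G ∣ flecLin G ∧ G ∣ flecConst G := by
  obtain ⟨h1, h2⟩ := totalDegree_flec_le G
  constructor
  · refine h.dvd_of_meets hG hR hB (fun q hq => h1.trans_lt (hdR q hq))
      (fun q hq => h1.trans_lt (hdB q hq)) ?_ (by nlinarith)
    exact fun q hq m hm x hx =>
      (eval_flec_eq_zero (hR q hq) (hB m hm) (h.dir q hq m hm) hx).1
  · refine h.dvd_of_meets hG hR hB (fun q hq => h2.trans_lt (hdR q hq))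
      (fun q hq => h2.trans_lt (hdB q hq)) ?_ (by nlinarith)
    exact fun q hq m hm x hx =>
      (eval_flec_eq_zero (hR q hq) (hB m hm) (h.dir q hq m hm) hx).2

lemma LineConfig.pderiv_two_ne_zero (h : LineConfig κ R B) (p : ℕ) [CharP K p]
    {G : MvPolynomial (Fin 3) K}
    (hG : Prime G) (hGp : G.totalDegree < p)
    (hR : ∀ q ∈ R, lineRestrict q G = 0) (hB : ∀ q ∈ B, lineRestrict q G = 0)
    (hdR : ∀ q ∈ R, G.totalDegree < #{m ∈ B | LineAdj q m})
    (hdB : ∀ q ∈ B, G.totalDegree < #{m ∈ R | LineAdj q m}) (hpos : 0 < G.totalDegree)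
    (hcard : G.totalDegree ^ 2 < #R + #B) : pderiv 2 G ≠ 0 := by
  intro h0
  have hd : ∀ i, (pderiv i G).totalDegree < G.totalDegree := fun i =>
    (totalDegree_pderiv_le i G).trans_lt (by omega)
  have hmeet : ∀ q ∈ R, ∀ m ∈ B, ∀ x, linePt q x = linePt m x →
      eval (linePt q x) (pderiv 1 G) = 0 ∧ eval (linePt q x) (pderiv 0 G) = 0 := by
    intro q hq m hm x hx
    have e1 := eval_dirDeriv_eq_zero (hR q hq) x
    have e2 := eval_dirDeriv_eq_zero (hB m hm) x
    rw [← hx] at e2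
    rw [eval_dirDeriv, h0, map_zero] at e1 e2
    have e3 : (q.1 - m.1) * eval (linePt q x) (pderiv 1 G) = 0 := by linear_combination e1 - e2
    have e4 := (mul_eq_zero.mp e3).resolve_left (sub_ne_zero.mpr (h.dir q hq m hm))
    exact ⟨e4, by simpa [e4] using e1⟩
  have h1 : pderiv 1 G = 0 := eq_zero_of_dvd_of_totalDegree_lt
    (h.dvd_of_meets hG hR hB (fun q hq => (hd 1).trans (hdR q hq))
      (fun q hq => (hd 1).trans (hdB q hq)) (fun q hq m hm x hx => (hmeet q hq m hm x hx).1)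
      (by nlinarith [hd 1])) (hd 1)
  have h2 : pderiv 0 G = 0 := eq_zero_of_dvd_of_totalDegree_lt
    (h.dvd_of_meets hG hR hB (fun q hq => (hd 0).trans (hdR q hq))
      (fun q hq => (hd 0).trans (hdB q hq)) (fun q hq m hm x hx => (hmeet q hq m hm x hx).2)
      (by nlinarith [hd 0])) (hd 0)
  refine hpos.ne' (totalDegree_eq_zero_of_pderiv p hGp fun i => ?_)
  fin_cases i
  · exact h2
  · exact h1
  · exact h0

end Config

section Regulus

open MvPolynomial

variable {K : Type*} [Field K]

/-- At a point `P` where `pderiv 2 G` does not vanish, this vanishes if and only if the line `a`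
meets one of the two lines through `P` whose direction `(1, t, t²)` is tangent to `G = 0`. -/
noncomputable def regulusPoly (a : K × K × K) (G : MvPolynomial (Fin 3) K) :
    MvPolynomial (Fin 3) K :=
  pderiv 0 G * (C a.2.1 + C a.1 * X 0 - X 1) * (C a.2.1 + C a.1 * X 0 - X 1) -
    pderiv 1 G * (X 2 - C a.2.2 - C a.1 * X 1) * (C a.2.1 + C a.1 * X 0 - X 1) +
    pderiv 2 G * (X 2 - C a.2.2 - C a.1 * X 1) * (X 2 - C a.2.2 - C a.1 * X 1)

lemma eval_regulusPoly_eq_zero {a : K × K × K} {G : MvPolynomial (Fin 3) K} {P : Fin 3 → K}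
    {t : K} (hQ : eval P (dirDeriv t G) = 0) (ha : LineAdj a (lineThrough P t)) :
    eval P (regulusPoly a G) = 0 := by
  rw [eval_dirDeriv] at hQ
  simp only [LineAdj, lineThrough] at ha
  simp only [regulusPoly, map_add, map_sub, map_mul, eval_C, eval_X]
  generalize eval P (pderiv 0 G) = c0 at hQ ⊢
  generalize eval P (pderiv 1 G) = c1 at hQ ⊢
  generalize eval P (pderiv 2 G) = c2 at hQ ⊢
  have h1 : P 2 - a.2.2 - a.1 * P 1 = - t * (a.2.1 + a.1 * P 0 - P 1) := by
    linear_combination -ha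
  rw [h1]
  linear_combination (a.2.1 + a.1 * P 0 - P 1) ^ 2 * hQ

lemma lineAdj_of_eval_regulusPoly {a : K × K × K} {G : MvPolynomial (Fin 3) K} {P : Fin 3 → K}
    {t s : K} (ht : eval P (dirDeriv t G) = 0) (hs : eval P (dirDeriv s G) = 0) (hts : t ≠ s)
    (hc : eval P (pderiv 2 G) ≠ 0) (h0 : eval P (regulusPoly a G) = 0)
    (ha : ¬ LineAdj a (lineThrough P t)) : LineAdj a (lineThrough P s) := by
  rw [eval_dirDeriv] at ht hs
  simp only [LineAdj, lineThrough] at ha ⊢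
  simp only [regulusPoly, map_add, map_sub, map_mul, eval_C, eval_X] at h0
  generalize eval P (pderiv 0 G) = c0 at *
  generalize eval P (pderiv 1 G) = c1 at *
  generalize eval P (pderiv 2 G) = c2 at *
  have h1 : c1 = - c2 * (t + s) := by
    have : (t - s) * (c1 + c2 * (t + s)) = 0 := by linear_combination ht - hs
    linear_combination (mul_eq_zero.mp this).resolve_left (sub_ne_zero.mpr hts)
  have h2 : c0 = c2 * (t * s) := by
    rw [h1] at ht
    linear_combination ht
  rw [h1, h2] at h0
  have h3 : c2 * ((a.2.2 - (P 2 - t * P 1) + a.1 * (P 1 - t * P 0) - t * a.2.1) *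
      (a.2.2 - (P 2 - s * P 1) + a.1 * (P 1 - s * P 0) - s * a.2.1)) = 0 := by
    linear_combination h0
  exact (mul_eq_zero.mp ((mul_eq_zero.mp h3).resolve_left hc)).resolve_left ha

lemma lineThrough_eq_of_linePt {q : K × K × K} {P : Fin 3 → K} {x : K} (h : linePt q x = P) :
    lineThrough P q.1 = q := by
  rw [← h, lineThrough_linePt]

lemma dvd_regulusPoly [Infinite K] (p : ℕ) [CharP K p] {G : MvPolynomial (Fin 3) K}
    (hG : Prime G) (hlin : G ∣ flecLin G) (hconst : G ∣ flecConst G) (hdeg : G.totalDegree < p)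
    {a : K × K × K} (ha : lineRestrict a G = 0)
    (hne : lineRestrict a (pderiv 2 G * (pderiv 1 G + C (2 * a.1) * pderiv 2 G)) ≠ 0) :
    G ∣ regulusPoly a G := by
  classical
  by_contra hdvd
  set f := lineRestrict a (pderiv 2 G * (pderiv 1 G + C (2 * a.1) * pderiv 2 G)) with hf
  obtain ⟨S, hS⟩ := (((f.roots.toFinset : Set K).toFinite).infinite_compl).exists_subset_card_eq
    (G.totalDegree * (regulusPoly a G).totalDegree + 1)
  let slope : K → K := fun x =>
    - eval (linePt a x) (pderiv 1 G) / eval (linePt a x) (pderiv 2 G) - a.1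
  let m : K → K × K × K := fun x => lineThrough (linePt a x) (slope x)
  have hx : ∀ x ∈ S, eval (linePt a x) (pderiv 2 G) ≠ 0 ∧ slope x ≠ a.1 ∧
      eval (linePt a x) (dirDeriv (slope x) G) = 0 := by
    intro x hx
    have h1 : f.eval x ≠ 0 := by
      have := hS.1 hx
      simpa [hne] using this
    rw [hf, eval_lineRestrict] at h1
    simp only [map_mul, map_add, eval_C] at h1
    have h2 := left_ne_zero_of_mul h1
    have h3 := right_ne_zero_of_mul h1
    refine ⟨h2, fun h4 => h3 ?_, ?_⟩
    · simp only [slope] at h4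
      field_simp at h4
      linear_combination -h4
    · have h5 := eval_dirDeriv_eq_zero ha x
      rw [eval_dirDeriv] at h5 ⊢
      simp only [slope]
      field_simp
      linear_combination eval (linePt a x) (pderiv 2 G) * h5
  have hmx : ∀ x, linePt (m x) x = linePt a x := fun x => linePt_lineThrough (linePt a x) (slope x)
  have hm0 : ∀ x ∈ S, lineRestrict (m x) G = 0 := fun x hxS =>
    lineRestrict_lineThrough_eq_zero p hlin hconst hdeg (eval_linePt_of_lineRestrict ha x)
      (hx x hxS).2.2 (hx x hxS).1
  have hinj : Set.InjOn m S := by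
    intro x hxS y _ hxy
    by_contra hne
    have h1 := (linePt_eq_iff.mp (hmx x)).1
    have h2 := (linePt_eq_iff.mp (hmx y)).1
    rw [← hxy] at h2
    have h3 : ((m x).1 - a.1) * (x - y) = 0 := by linear_combination h1 - h2
    exact (mul_ne_zero (sub_ne_zero.mpr (hx x hxS).2.1) (sub_ne_zero.mpr hne)) h3
  have hcard := card_common_lines_le hG hdvd (S.image m) (by
    intro q hq
    obtain ⟨x, hxS, rfl⟩ := mem_image.mp hq
    exact hm0 x hxS) (by
    intro q hq
    obtain ⟨x, hxS, rfl⟩ := mem_image.mp hq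
    refine lineRestrict_eq_zero_of_forall fun y => ?_
    refine eval_regulusPoly_eq_zero (t := (m x).1) (eval_dirDeriv_eq_zero (hm0 x hxS) y) ?_
    rw [lineThrough_linePt]
    exact (lineAdj_of_linePt_eq (hmx x)).symm)
  rw [card_image_of_injOn hinj, hS.2] at hcard
  omega

end Regulus

section Irreducible

open MvPolynomial

variable {K : Type*} [Field K] [DecidableEq K] {κ : ℕ} {R B : Finset (K × K × K)}

lemma LineConfig.lineRestrict_slope_ne_zero (h : LineConfig κ R B) {G : MvPolynomial (Fin 3) K}
    (hR : ∀ q ∈ R, lineRestrict q G = 0) (hB : ∀ q ∈ B, lineRestrict q G = 0)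
    {a : K × K × K} (ha : a ∈ R) (hda : G.totalDegree < #{m ∈ B | LineAdj a m})
    (hca : lineRestrict a (pderiv 2 G) ≠ 0) :
    lineRestrict a (pderiv 2 G * (pderiv 1 G + C (2 * a.1) * pderiv 2 G)) ≠ 0 := by
  intro h0
  refine hca (lineRestrict_eq_zero_of_meets (M := {m ∈ B | LineAdj a m}) ?_ ?_ ?_ ?_
    (((totalDegree_pderiv_le 2 G).trans (Nat.sub_le _ _)).trans_lt hda))
  · exact fun m hm => (mem_filter.mp hm).2
  · exact fun m hm => h.dir a ha m (mem_filter.mp hm).1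
  · exact fun m hm r hr => h.sep_right m (mem_filter.mp hm).1 r (mem_filter.mp hr).1
  · intro m hm x hx
    have hmB := (mem_filter.mp hm).1
    by_contra hc
    have e0 := eval_linePt_of_lineRestrict h0 x
    have e1 := eval_dirDeriv_eq_zero (hR a ha) x
    have e2 := eval_dirDeriv_eq_zero (hB m hmB) x
    rw [← hx] at e2
    rw [eval_dirDeriv] at e1 e2
    simp only [map_mul, map_add, eval_C] at e0
    have hd := sub_ne_zero.mpr (h.dir a ha m hmB)
    have e3 : (a.1 - m.1) * (eval (linePt a x) (pderiv 1 G) +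
        (a.1 + m.1) * eval (linePt a x) (pderiv 2 G)) = 0 := by
      linear_combination e1 - e2
    have e4 := (mul_eq_zero.mp e3).resolve_left hd
    have e5 := (mul_eq_zero.mp e0).resolve_left hc
    have e6 : (a.1 - m.1) * eval (linePt a x) (pderiv 2 G) = 0 := by linear_combination e5 - e4
    exact mul_ne_zero hd hc e6

lemma LineConfig.card_filter_le_of_regulus (h : LineConfig κ R B)
    {G : MvPolynomial (Fin 3) K}
    (hR : ∀ q ∈ R, lineRestrict q G = 0) (hB : ∀ q ∈ B, lineRestrict q G = 0)
    {a b : K × K × K} (ha : a ∈ R) (hb : b ∈ R) (hab : a ≠ b) (hreg : G ∣ regulusPoly a G)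
    (hcb : lineRestrict b (pderiv 2 G) ≠ 0) :
    #{m ∈ B | LineAdj b m} ≤ κ + G.totalDegree := by
  have hbad : #{m ∈ B | LineAdj b m ∧ ¬ LineAdj a m} ≤ G.totalDegree := by
    by_contra! hlt
    refine hcb (lineRestrict_eq_zero_of_meets (M := {m ∈ B | LineAdj b m ∧ ¬ LineAdj a m})
      ?_ ?_ ?_ ?_ (((totalDegree_pderiv_le 2 G).trans (Nat.sub_le _ _)).trans_lt hlt))
    · exact fun m hm => (mem_filter.mp hm).2.1
    · exact fun m hm => h.dir b hb m (mem_filter.mp hm).1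
    · exact fun m hm r hr => h.sep_right m (mem_filter.mp hm).1 r (mem_filter.mp hr).1
    · intro m hm x hx
      obtain ⟨hmB, _, hma⟩ := mem_filter.mp hm
      by_contra hc
      have e2 := eval_dirDeriv_eq_zero (hB m hmB) x
      rw [← hx] at e2
      have e3 : eval (linePt b x) (regulusPoly a G) = 0 := by
        obtain ⟨c, hc⟩ := hreg
        rw [hc, map_mul, eval_linePt_of_lineRestrict (hR b hb), zero_mul]
      have e4 := lineAdj_of_eval_regulusPoly (eval_dirDeriv_eq_zero (hR b hb) x) e2
        (h.dir b hb m hmB) hc e3 (by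
          rw [lineThrough_linePt]
          exact fun hadj => hab (h.sep_left a ha b hb hadj))
      rw [lineThrough_eq_of_linePt hx.symm] at e4
      exact hma e4
  have hcod := h.codeg_left b hb a ha hab.symm
  have : #{m ∈ B | LineAdj b m} ≤ #{m ∈ B | LineAdj b m ∧ LineAdj a m} +
      #{m ∈ B | LineAdj b m ∧ ¬ LineAdj a m} := by
    rw [← filter_filter, ← filter_filter,
      card_filter_add_card_filter_not (s := {m ∈ B | LineAdj b m}) (fun m => LineAdj a m)]
  omega

lemma LineConfig.false_of_two_good [Infinite K] (h : LineConfig κ R B) (p : ℕ) [CharP K p]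
    {G : MvPolynomial (Fin 3) K} (hG : Prime G) (hGp : G.totalDegree < p)
    (hlin : G ∣ flecLin G) (hconst : G ∣ flecConst G)
    (hR : ∀ q ∈ R, lineRestrict q G = 0) (hB : ∀ q ∈ B, lineRestrict q G = 0)
    (hdR : ∀ q ∈ R, κ + G.totalDegree < #{m ∈ B | LineAdj q m})
    {a b : K × K × K} (ha : a ∈ R) (hb : b ∈ R) (hab : a ≠ b)
    (hca : lineRestrict a (pderiv 2 G) ≠ 0) (hcb : lineRestrict b (pderiv 2 G) ≠ 0) : False := by
  have hda : G.totalDegree < #{m ∈ B | LineAdj a m} := by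
    have := hdR a ha
    omega
  exact (hdR b hb).not_ge (h.card_filter_le_of_regulus hR hB ha hb hab
    (dvd_regulusPoly p hG hlin hconst hGp (hR a ha)
      (h.lineRestrict_slope_ne_zero hR hB ha hda hca)) hcb)

lemma LineConfig.not_prime [Infinite K] (h : LineConfig κ R B) (p : ℕ) [CharP K p]
    {G : MvPolynomial (Fin 3) K} (hG : Prime G) (hGp : G.totalDegree < p)
    (hR : ∀ q ∈ R, lineRestrict q G = 0) (hB : ∀ q ∈ B, lineRestrict q G = 0)
    (hdR : ∀ q ∈ R, κ + 4 * G.totalDegree < #{m ∈ B | LineAdj q m})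
    (hdB : ∀ q ∈ B, κ + 4 * G.totalDegree < #{m ∈ R | LineAdj q m})
    (hpos : 0 < #R + #B) (hcard : 5 * G.totalDegree ^ 2 ≤ #R + #B) : False := by
  classical
  have hdpos : 0 < G.totalDegree := by
    have : 0 < #R ∨ 0 < #B := by omega
    rcases this with h1 | h1 <;> obtain ⟨q, hq⟩ := card_pos.mp h1
    · exact totalDegree_pos_of_lineRestrict hG.ne_zero (hR q hq)
    · exact totalDegree_pos_of_lineRestrict hG.ne_zero (hB q hq)
  set d := G.totalDegree with hd
  obtain ⟨hlin, hconst⟩ := h.dvd_flec hG hR hB (fun q hq => by have := hdR q hq; omega)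
    (fun q hq => by have := hdB q hq; omega) (by nlinarith)
  have hc2 := h.pderiv_two_ne_zero p hG hGp hR hB (fun q hq => by have := hdR q hq; omega)
    (fun q hq => by have := hdB q hq; omega) hdpos (by nlinarith)
  have hdeg : (pderiv 2 G).totalDegree < d := (totalDegree_pderiv_le 2 G).trans_lt (by omega)
  have hndvd : ¬ G ∣ pderiv 2 G := fun hdvd => hc2 (eq_zero_of_dvd_of_totalDegree_lt hdvd hdeg)
  have hbad := card_common_lines_le hG hndvd {q ∈ R ∪ B | lineRestrict q (pderiv 2 G) = 0}
    (fun q hq => (mem_union.mp (mem_filter.mp hq).1).elim (hR q) (hB q))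
    (fun q hq => (mem_filter.mp hq).2)
  have hsplit := card_filter_add_card_filter_not (s := R ∪ B)
    (fun q => lineRestrict q (pderiv 2 G) = 0)
  rw [card_union_of_disjoint h.disjoint] at hsplit
  have hun : #{q ∈ R ∪ B | ¬ lineRestrict q (pderiv 2 G) = 0} ≤
      #{q ∈ R | ¬ lineRestrict q (pderiv 2 G) = 0} +
        #{q ∈ B | ¬ lineRestrict q (pderiv 2 G) = 0} := by
    rw [filter_union]
    exact card_union_le _ _
  have h3 : 1 < #{q ∈ R | ¬ lineRestrict q (pderiv 2 G) = 0} ∨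
      1 < #{q ∈ B | ¬ lineRestrict q (pderiv 2 G) = 0} := by
    by_contra! hcon
    nlinarith
  rcases h3 with h3 | h3 <;> obtain ⟨a, ha, b, hb, hab⟩ := one_lt_card.mp h3 <;>
    rw [mem_filter] at ha hb
  · exact h.false_of_two_good p hG hGp hlin hconst hR hB
      (fun q hq => by have := hdR q hq; omega) ha.1 hb.1 hab ha.2 hb.2
  · exact h.symm.false_of_two_good p hG hGp hlin hconst hB hR
      (fun q hq => by have := hdB q hq; omega) ha.1 hb.1 hab ha.2 hb.2

end Irreducible

section Reducible

open MvPolynomial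

variable {K : Type*} [Field K]

lemma totalDegree_pos_of_not_isUnit {σ : Type*} {G : MvPolynomial σ K} (hG : G ≠ 0)
    (h : ¬ IsUnit G) : 0 < G.totalDegree := by
  rw [pos_iff_ne_zero]
  intro h0
  rw [totalDegree_eq_zero_iff_eq_C] at h0
  rw [h0] at h hG
  exact h ((isUnit_iff_ne_zero.mpr fun hc => hG (by rw [hc, C_0])).map C)

variable [DecidableEq K] {κ : ℕ} {R B : Finset (K × K × K)}

open scoped Classical in
lemma LineConfig.card_meets_le (h : LineConfig κ R B) {H : MvPolynomial (Fin 3) K}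
    {q : K × K × K} (hq : q ∈ R) (hqH : lineRestrict q H ≠ 0) :
    #{m ∈ B | LineAdj q m} ≤
      #{m ∈ {m ∈ B | lineRestrict m H ≠ 0} | LineAdj q m} + H.totalDegree := by
  have h1 : #{m ∈ B | LineAdj q m ∧ ¬ lineRestrict m H ≠ 0} ≤ H.totalDegree := by
    by_contra! hlt
    refine hqH (lineRestrict_eq_zero_of_meets ?_ ?_ ?_ ?_ hlt)
    · exact fun m hm => (mem_filter.mp hm).2.1
    · exact fun m hm => h.dir q hq m (mem_filter.mp hm).1
    · exact fun m hm r hr => h.sep_right m (mem_filter.mp hm).1 r (mem_filter.mp hr).1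
    · intro m hm x hx
      rw [hx]
      exact eval_linePt_of_lineRestrict (mem_filter.mp hm).2.2 x
  have h2 := card_filter_add_card_filter_not (s := {m ∈ B | LineAdj q m})
    (fun m => lineRestrict m H ≠ 0)
  rw [filter_filter, filter_filter] at h2
  have h3 : #{m ∈ {m ∈ B | lineRestrict m H ≠ 0} | LineAdj q m} =
      #{m ∈ B | LineAdj q m ∧ lineRestrict m H ≠ 0} := by
    rw [filter_filter]
    simp only [and_comm]
  omega

/-- A configuration of lines cannot be contained in a surface of small degree if every line meets
many lines of the other family. -/
theorem LineConfig.not_subset_surface [Infinite K] (p : ℕ) [CharP K p]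
    (G : MvPolynomial (Fin 3) K) (hG : G ≠ 0) (hGp : G.totalDegree < p)
    (h : LineConfig κ R B)
    (hR : ∀ q ∈ R, lineRestrict q G = 0) (hB : ∀ q ∈ B, lineRestrict q G = 0)
    (hdR : ∀ q ∈ R, κ + 4 * G.totalDegree < #{m ∈ B | LineAdj q m})
    (hdB : ∀ q ∈ B, κ + 4 * G.totalDegree < #{m ∈ R | LineAdj q m})
    (hpos : 0 < #R + #B) (hcard : 5 * G.totalDegree ^ 2 ≤ #R + #B) : False := by
  classical
  induction hn : G.totalDegree using Nat.strong_induction_on generalizing G R B with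
  | _ n ih =>
  subst hn
  have hdpos : 0 < G.totalDegree := by
    have : 0 < #R ∨ 0 < #B := by omega
    rcases this with h1 | h1 <;> obtain ⟨q, hq⟩ := card_pos.mp h1
    · exact totalDegree_pos_of_lineRestrict hG (hR q hq)
    · exact totalDegree_pos_of_lineRestrict hG (hB q hq)
  have hGu : ¬ IsUnit G := by
    intro hu
    rw [isUnit_iff_totalDegree_of_isReduced] at hu
    omega
  obtain ⟨F, hF, H, rfl⟩ := WfDvdMonoid.exists_irreducible_factor hGu hG
  have hFp : Prime F := UniqueFactorizationMonoid.irreducible_iff_prime.mp hF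
  have hH0 := right_ne_zero_of_mul hG
  by_cases hu : IsUnit H
  · have hass : Associated F (F * H) := associated_mul_unit_right F H hu
    exact h.not_prime p (hass.prime hFp) hGp hR hB hdR hdB hpos hcard
  have hHd := totalDegree_pos_of_not_isUnit hH0 hu
  have hFd := totalDegree_pos_of_not_isUnit hFp.ne_zero hFp.not_isUnit
  have hdeg := totalDegree_mul_of_isDomain hFp.ne_zero hH0
  rw [hdeg] at hdR hdB hcard hGp hdpos
  have hRz : ∀ q ∈ R, lineRestrict q F = 0 ∨ lineRestrict q H = 0 := fun q hq => by
    rw [← mul_eq_zero, ← map_mul, hR q hq]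
  have hBz : ∀ q ∈ B, lineRestrict q F = 0 ∨ lineRestrict q H = 0 := fun q hq => by
    rw [← mul_eq_zero, ← map_mul, hB q hq]
  by_cases hFH : F ∣ H
  · have hz : ∀ q, lineRestrict q F = 0 → lineRestrict q H = 0 := by
      intro q hq
      obtain ⟨c, hc⟩ := hFH
      rw [hc, map_mul, hq, zero_mul]
    refine ih H.totalDegree (by omega) H hH0 (by omega) h
      (fun q hq => (hRz q hq).elim (hz q) id) (fun q hq => (hBz q hq).elim (hz q) id)
      (fun q hq => ?_) (fun q hq => ?_) hpos (by nlinarith) rfl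
    · have := hdR q hq
      omega
    · have := hdB q hq
      omega
  have hcom := card_common_lines_le hFp hFH
    {q ∈ R ∪ B | lineRestrict q F = 0 ∧ lineRestrict q H = 0}
    (fun q hq => (mem_filter.mp hq).2.1) (fun q hq => (mem_filter.mp hq).2.2)
  have hcov : #(R ∪ B) ≤ #{q ∈ R ∪ B | lineRestrict q F = 0 ∧ lineRestrict q H = 0} +
      (#{q ∈ R | lineRestrict q H ≠ 0} + #{q ∈ B | lineRestrict q H ≠ 0} +
      (#{q ∈ R | lineRestrict q F ≠ 0} + #{q ∈ B | lineRestrict q F ≠ 0})) := by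
    refine (card_le_card (t := {q ∈ R ∪ B | lineRestrict q F = 0 ∧ lineRestrict q H = 0} ∪
      (({q ∈ R | lineRestrict q H ≠ 0} ∪ {q ∈ B | lineRestrict q H ≠ 0}) ∪
      ({q ∈ R | lineRestrict q F ≠ 0} ∪ {q ∈ B | lineRestrict q F ≠ 0}))) ?_).trans
      ((card_union_le _ _).trans (Nat.add_le_add_left ((card_union_le _ _).trans
        (Nat.add_le_add (card_union_le _ _) (card_union_le _ _))) _))
    intro q hq
    simp only [mem_union, mem_filter] at hq ⊢
    tauto
  rw [card_union_of_disjoint h.disjoint] at hcov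
  have key : ∀ F' H' : MvPolynomial (Fin 3) K, F' ≠ 0 → 0 < H'.totalDegree →
      F'.totalDegree + H'.totalDegree = F.totalDegree + H.totalDegree →
      (∀ q ∈ R, lineRestrict q F' = 0 ∨ lineRestrict q H' = 0) →
      (∀ q ∈ B, lineRestrict q F' = 0 ∨ lineRestrict q H' = 0) →
      #{q ∈ R | lineRestrict q H' ≠ 0} + #{q ∈ B | lineRestrict q H' ≠ 0} ≤
        5 * F'.totalDegree ^ 2 := by
    intro F' H' hF' hH' hsum hR' hB'
    by_contra! hlt
    have hsymm := h.symm
    refine ih F'.totalDegree (by omega) F' hF' (by omega)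
      (h.mono (filter_subset _ _) (filter_subset _ _)) ?_ ?_ ?_ ?_ (by omega) hlt.le rfl
    · exact fun q hq => (hR' q (mem_filter.mp hq).1).resolve_right (mem_filter.mp hq).2
    · exact fun q hq => (hB' q (mem_filter.mp hq).1).resolve_right (mem_filter.mp hq).2
    · intro q hq
      obtain ⟨hq, hqH⟩ := mem_filter.mp hq
      have := h.card_meets_le hq hqH
      have := hdR q hq
      omega
    · intro q hq
      obtain ⟨hq, hqH⟩ := mem_filter.mp hq
      have := hsymm.card_meets_le hq hqH
      have := hdB q hq
      omega
  have k1 := key F H hFp.ne_zero hHd rfl hRz hBz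
  have k2 := key H F hH0 hFd (add_comm _ _) (fun q hq => (hRz q hq).symm)
    (fun q hq => (hBz q hq).symm)
  nlinarith

end Reducible

section Sampling

lemma sum_prod_half_pow {ι : Type*} [Fintype ι] [DecidableEq ι] (N : Finset ι) (c : Fin 15) :
    ∑ f : ι → Fin 15, (1 / 2 : ℝ) ^ #{i ∈ N | f i = c} =
      15 ^ Fintype.card ι * (29 / 30) ^ #N := by
  have h1 : ∀ f : ι → Fin 15, (1 / 2 : ℝ) ^ #{i ∈ N | f i = c} =
      ∏ i, if i ∈ N ∧ f i = c then (1 / 2 : ℝ) else 1 := by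
    intro f
    rw [prod_ite, prod_const_one, mul_one, prod_const]
    congr 2
    ext i
    simp
  have h2 : ∀ i : ι, ∑ j : Fin 15, (if i ∈ N ∧ j = c then (1 / 2 : ℝ) else 1) =
      15 * if i ∈ N then 29 / 30 else 1 := by
    intro i
    by_cases hi : i ∈ N
    · simp only [hi, true_and, if_true]
      have : ∀ j : Fin 15, (if j = c then (1 / 2 : ℝ) else 1) = 1 - if j = c then 1 / 2 else 0 := by
        intro j
        split_ifs <;> norm_num
      simp only [this, sum_sub_distrib, sum_ite_eq', mem_univ, if_true]
      norm_num
    · simp [hi]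
  have h3 := prod_univ_sum (fun _ : ι => (univ : Finset (Fin 15)))
    (fun i j => if i ∈ N ∧ j = c then (1 / 2 : ℝ) else 1)
  rw [Fintype.piFinset_univ] at h3
  simp only [h1]
  rw [← h3]
  simp only [h2]
  rw [prod_mul_distrib, prod_const, card_univ, prod_ite_mem, univ_inter, prod_const]

/-- A family of large subsets of `ι` has a sparse set meeting each of them often. -/
lemma exists_sparse_of_fintype {ι β : Type*} [Fintype ι] [DecidableEq ι] (B : Finset β)
    (N : β → Finset ι) {s : ℕ} (hs : 1 ≤ s) (hB : #B ≤ s ^ 2)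
    (hN : ∀ b ∈ B, 147 * s ≤ #(N b)) :
    ∃ S : Finset ι, 15 * #S ≤ Fintype.card ι ∧ ∀ b ∈ B, s < #{i ∈ N b | i ∈ S} := by
  classical
  have hgood : ∃ f : ι → Fin 15, ∀ b ∈ B, ∀ c, s < #{i ∈ N b | f i = c} := by
    by_contra! hcon
    have h1 : ∀ f : ι → Fin 15, (1 : ℝ) ≤
        2 ^ s * ∑ b ∈ B, ∑ c, (1 / 2 : ℝ) ^ #{i ∈ N b | f i = c} := by
      intro f
      obtain ⟨b, hb, c, hbc⟩ := hcon f
      have h2 : (1 / 2 : ℝ) ^ s ≤ ∑ b ∈ B, ∑ c, (1 / 2 : ℝ) ^ #{i ∈ N b | f i = c} :=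
        calc (1 / 2 : ℝ) ^ s ≤ (1 / 2 : ℝ) ^ #{i ∈ N b | f i = c} :=
              pow_le_pow_of_le_one (by norm_num) (by norm_num) hbc
          _ ≤ ∑ c, (1 / 2 : ℝ) ^ #{i ∈ N b | f i = c} :=
              single_le_sum (f := fun c => (1 / 2 : ℝ) ^ #{i ∈ N b | f i = c})
                (fun _ _ => by positivity) (mem_univ c)
          _ ≤ _ := single_le_sum (f := fun b => ∑ c, (1 / 2 : ℝ) ^ #{i ∈ N b | f i = c})
                (fun _ _ => by positivity) hb
      calc (1 : ℝ) = 2 ^ s * (1 / 2) ^ s := by rw [← mul_pow]; norm_num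
        _ ≤ _ := by gcongr
    have h3 : (15 : ℝ) ^ Fintype.card ι ≤
        2 ^ s * ∑ b ∈ B, ∑ _c : Fin 15, 15 ^ Fintype.card ι * (29 / 30 : ℝ) ^ #(N b) := by
      have := sum_le_sum fun f (_ : f ∈ (univ : Finset (ι → Fin 15))) => h1 f
      rw [← mul_sum, sum_comm] at this
      simp only [sum_comm (s := (univ : Finset (ι → Fin 15))), sum_prod_half_pow] at this
      simpa using this
    have h4 : ∀ b ∈ B, ∑ _c : Fin 15, 15 ^ Fintype.card ι * (29 / 30 : ℝ) ^ #(N b) ≤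
        15 * (15 ^ Fintype.card ι * (29 / 30) ^ (147 * s)) := by
      intro b hb
      simp only [sum_const, card_univ, Fintype.card_fin, nsmul_eq_mul]
      push_cast
      gcongr 15 * (_ * ?_)
      exact pow_le_pow_of_le_one (by norm_num) (by norm_num) (hN b hb)
    have h5 := sum_le_sum h4
    rw [sum_const, nsmul_eq_mul] at h5
    have h6 : (29 / 30 : ℝ) ^ (147 * s) ≤ (1 / 2) ^ (7 * s) := by
      rw [show 147 * s = 21 * (7 * s) by ring, pow_mul _ 21]
      exact pow_le_pow_left₀ (by positivity) (by norm_num) _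
    have h7 : (#B : ℝ) ≤ 4 ^ s := by
      have : #B < 4 ^ s := by
        calc #B ≤ s ^ 2 := hB
          _ < (2 ^ s) ^ 2 := Nat.pow_lt_pow_left s.lt_two_pow_self (by norm_num)
          _ = 4 ^ s := by
            rw [← pow_mul, mul_comm, pow_mul]
            norm_num
      exact_mod_cast this.le
    have h8 : (15 : ℝ) < 16 ^ s := by
      calc (15 : ℝ) < 16 ^ 1 := by norm_num
        _ ≤ 16 ^ s := pow_le_pow_right₀ (by norm_num) hs
    have hP : (0 : ℝ) < 15 ^ Fintype.card ι := by positivity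
    have h9 : (15 : ℝ) ^ Fintype.card ι ≤
        2 ^ s * (4 ^ s * (15 * (15 ^ Fintype.card ι * (1 / 2) ^ (7 * s)))) := by
      refine h3.trans (mul_le_mul_of_nonneg_left (h5.trans ?_) (by positivity))
      gcongr
    have h10 : (2 : ℝ) ^ s * (4 ^ s * (16 ^ s * (1 / 2) ^ (7 * s))) = 1 := by
      rw [pow_mul, ← mul_pow, ← mul_pow, ← mul_pow]
      norm_num
    have h11 : (0 : ℝ) < 2 ^ s * (4 ^ s * (1 / 2) ^ (7 * s)) := by positivity
    nlinarith [mul_lt_mul_of_pos_left h8 (mul_pos h11 hP)]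
  obtain ⟨f, hf⟩ := hgood
  have hsum : ∑ c, #{i : ι | f i = c} = Fintype.card ι := by
    rw [← card_univ, card_eq_sum_card_fiberwise (f := f) (t := univ) (by simp)]
  obtain ⟨c, hc⟩ : ∃ c, 15 * #{i : ι | f i = c} ≤ Fintype.card ι := by
    by_contra! hcon
    have := sum_lt_sum_of_nonempty univ_nonempty fun c (_ : c ∈ (univ : Finset (Fin 15))) => hcon c
    rw [← mul_sum, hsum] at this
    simp at this
  refine ⟨univ.filter fun i => f i = c, hc, fun b hb => ?_⟩
  simpa using hf b hb c

lemma exists_sparse {α β : Type*} (R : Finset α) (B : Finset β)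
    (adj : β → α → Prop) [∀ b, DecidablePred (adj b)] {s : ℕ} (hs : 1 ≤ s) (hB : #B ≤ s ^ 2)
    (hN : ∀ b ∈ B, 147 * s ≤ #{q ∈ R | adj b q}) :
    ∃ S ⊆ R, 15 * #S ≤ #R ∧ ∀ b ∈ B, s < #{q ∈ S | adj b q} := by
  classical
  obtain ⟨S, hS, hSB⟩ := exists_sparse_of_fintype (ι := R) B
    (fun b => {q : R | adj b q}) hs hB (fun b hb => (hN b hb).trans_eq (by
      rw [← card_map (Function.Embedding.subtype _)]
      congr 1
      ext q
      simp [and_comm]))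
  refine ⟨S.map (Function.Embedding.subtype _), ?_, ?_, fun b hb => ?_⟩
  · intro q hq
    obtain ⟨r, _, rfl⟩ := mem_map.mp hq
    exact r.2
  · simpa using hS
  · refine (hSB b hb).trans_eq ?_
    rw [← card_map (Function.Embedding.subtype _)]
    congr 1
    ext q
    simp only [mem_map, mem_filter, mem_univ, true_and, Function.Embedding.subtype_apply]
    constructor
    · rintro ⟨r, ⟨h1, h2⟩, rfl⟩
      exact ⟨⟨r, h2, rfl⟩, h1⟩
    · rintro ⟨⟨r, h2, rfl⟩, h1⟩
      exact ⟨r, ⟨h1, h2⟩, rfl⟩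

end Sampling

section Incidence

lemma exists_min_degree {α β : Type*} [DecidableEq α] [DecidableEq β] (adj : α → β → Prop)
    [DecidableRel adj] (k : ℕ) (R : Finset α) (B : Finset β)
    (h : k * (#R + #B) < ∑ q ∈ R, #{m ∈ B | adj q m}) :
    ∃ R' ⊆ R, ∃ B' ⊆ B, 0 < #R' + #B' ∧ (∀ q ∈ R', k < #{m ∈ B' | adj q m}) ∧
      ∀ m ∈ B', k < #{q ∈ R' | adj q m} := by
  induction hn : #R + #B using Nat.strong_induction_on generalizing R B with
  | _ n ih =>
  by_cases hR : ∀ q ∈ R, k < #{m ∈ B | adj q m}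
  · by_cases hB : ∀ m ∈ B, k < #{q ∈ R | adj q m}
    · refine ⟨R, Subset.rfl, B, Subset.rfl, ?_, hR, hB⟩
      rcases R.eq_empty_or_nonempty with rfl | hne
      · simp at h
      · have := hne.card_pos
        omega
    · push Not at hB
      obtain ⟨m, hm, hmk⟩ := hB
      have hc := card_erase_add_one hm
      have hsum : ∑ q ∈ R, #{m ∈ B | adj q m} =
          #{q ∈ R | adj q m} + ∑ q ∈ R, #{m' ∈ B.erase m | adj q m'} := by
        have := sum_card_bipartiteAbove_eq_sum_card_bipartiteBelow (s := R) (t := B) adj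
        have h' := sum_card_bipartiteAbove_eq_sum_card_bipartiteBelow (s := R) (t := B.erase m) adj
        simp only [bipartiteAbove, bipartiteBelow] at this h'
        rw [this, h', add_sum_erase B (fun m => #{q ∈ R | adj q m}) hm]
      obtain ⟨R', hR', B', hB', h'⟩ := ih (#R + #(B.erase m)) (by omega) R (B.erase m)
        (by rw [← hc] at h; rw [hsum] at h; nlinarith) rfl
      exact ⟨R', hR', B', hB'.trans (erase_subset _ _), h'⟩
  · push Not at hR
    obtain ⟨q, hq, hqk⟩ := hR
    have hc := card_erase_add_one hq
    have hsum := add_sum_erase R (fun q => #{m ∈ B | adj q m}) hq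
    obtain ⟨R', hR', B', hB', h'⟩ := ih (#(R.erase q) + #B) (by omega) (R.erase q) B
      (by rw [← hc] at h; rw [← hsum] at h; nlinarith) rfl
    exact ⟨R', hR'.trans (erase_subset _ _), B', hB', h'⟩

variable {K : Type*} [Field K] [DecidableEq K] {κ : ℕ} {R B : Finset (K × K × K)}

lemma LineConfig.not_min_degree_of_card_le [Infinite K] (p : ℕ) [CharP K p]
    (h : LineConfig κ R B) {s : ℕ} (hs : 1 ≤ s) (hsp : s ≤ p) (hκ : κ ≤ s)
    (hBs : #B ≤ s ^ 2) (hRB : #R ≤ #B) (hpos : 0 < #R + #B)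
    (hR : ∀ q ∈ R, 147 * s < #{m ∈ B | LineAdj q m})
    (hB : ∀ q ∈ B, 147 * s < #{m ∈ R | LineAdj q m}) : False := by
  obtain ⟨S, hSR, hS, hSB⟩ := exists_sparse R B (fun b q => LineAdj b q) hs hBs
    fun b hb => (hB b hb).le
  obtain ⟨F, hF0, hFd, hFS⟩ := exists_vanishing S
  have hd : F.totalDegree < s := by
    by_contra! hcon
    have := Nat.pow_le_pow_left hcon 2
    have : 0 < s ^ 2 := by positivity
    omega
  have hFB : ∀ q ∈ B, lineRestrict q F = 0 := by
    intro q hq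
    refine lineRestrict_eq_zero_of_meets (M := {m ∈ S | LineAdj q m}) ?_ ?_ ?_ ?_
      (hd.trans (hSB q hq))
    · exact fun m hm => (mem_filter.mp hm).2
    · exact fun m hm => (h.dir m (hSR (mem_filter.mp hm).1) q hq).symm
    · exact fun m hm r hr => h.sep_left m (hSR (mem_filter.mp hm).1) r (hSR (mem_filter.mp hr).1)
    · intro m hm x hx
      rw [hx]
      exact eval_linePt_of_lineRestrict (hFS m (mem_filter.mp hm).1) x
  have hFR : ∀ q ∈ R, lineRestrict q F = 0 := by
    intro q hq
    refine lineRestrict_eq_zero_of_meets (M := {m ∈ B | LineAdj q m}) ?_ ?_ ?_ ?_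
      (lt_of_le_of_lt (by omega) (hR q hq))
    · exact fun m hm => (mem_filter.mp hm).2
    · exact fun m hm => h.dir q hq m (mem_filter.mp hm).1
    · exact fun m hm r hr => h.sep_right m (mem_filter.mp hm).1 r (mem_filter.mp hr).1
    · intro m hm x hx
      rw [hx]
      exact eval_linePt_of_lineRestrict (hFB m (mem_filter.mp hm).1) x
  refine h.not_subset_surface p F hF0 (hd.trans_le hsp) hFR hFB
    (fun q hq => lt_of_le_of_lt (by omega) (hR q hq))
    (fun q hq => lt_of_le_of_lt (by omega) (hB q hq)) hpos (by omega)

/-- Incidences between two families of at most `s²` lines of the generalised quadrangle. -/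
theorem LineConfig.card_adj_le [Infinite K] (p : ℕ) [CharP K p]
    (h : LineConfig κ R B) {s : ℕ} (hs : 1 ≤ s) (hsp : s ≤ p) (hκ : κ ≤ s)
    (hRs : #R ≤ s ^ 2) (hBs : #B ≤ s ^ 2) :
    ∑ q ∈ R, #{m ∈ B | LineAdj q m} ≤ 294 * s ^ 3 := by
  by_contra! hcon
  obtain ⟨R', hR', B', hB', hpos, hR, hB⟩ := exists_min_degree LineAdj (147 * s) R B
    (lt_of_le_of_lt (by nlinarith) hcon)
  have h' := h.mono hR' hB'
  have hB2 : ∀ q ∈ B', 147 * s < #{m ∈ R' | LineAdj q m} := by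
    intro q hq
    simpa only [lineAdj_comm] using hB q hq
  rcases le_total #R' #B' with hle | hle
  · exact h'.not_min_degree_of_card_le p hs hsp hκ ((card_le_card hB').trans hBs) hle hpos hR hB2
  · exact h'.symm.not_min_degree_of_card_le p hs hsp hκ ((card_le_card hR').trans hRs) hle
      (by omega) hB2 hR

end Incidence

section Generic

lemma exists_independent_triple (F K : Type*) [Field F] [Finite F] [Field K] [Infinite K]
    [Algebra F K] : ∃ α β : K, ∀ a b c : F,
      algebraMap F K a + algebraMap F K b * α + algebraMap F K c * β = 0 →
        a = 0 ∧ b = 0 ∧ c = 0 := by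
  classical
  have := Fintype.ofFinite F
  obtain ⟨α, hα⟩ := Infinite.exists_notMem_finset (univ.image fun a : F => algebraMap F K a)
  obtain ⟨β, hβ⟩ := Infinite.exists_notMem_finset
    (univ.image fun a : F × F => algebraMap F K a.1 + algebraMap F K a.2 * α)
  simp only [mem_image, mem_univ, true_and, not_exists, Prod.forall] at hα hβ
  refine ⟨α, β, fun a b c h => ?_⟩
  have hc : c = 0 := by
    by_contra hc
    have hc' : algebraMap F K c ≠ 0 := by simpa using hc
    refine hβ (-a / c) (-b / c) ?_
    simp only [map_div₀, map_neg]
    field_simp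
    linear_combination -h
  have hb : b = 0 := by
    by_contra hb
    have hb' : algebraMap F K b ≠ 0 := by simpa using hb
    refine hα (-a / b) ?_
    simp only [map_div₀, map_neg]
    field_simp
    subst hc
    simp only [map_zero] at h
    linear_combination -h
  subst hb hc
  simpa using h

/-- The lines over a finite field embed generically in two ways over an infinite extension. -/
lemma exists_generic_embeddings (F K : Type*) [Field F] [Finite F] [Field K] [Infinite K]
    [Algebra F K] : ∃ f g : F × F × F → K × K × K,
      (∀ q r, LineAdj (f q) (g r) ↔ LineAdj q r) ∧ (∀ q r, LineAdj (f q) (f r) → q = r) ∧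
        (∀ q r, LineAdj (g q) (g r) → q = r) ∧ ∀ q r, (f q).1 ≠ (g r).1 := by
  classical
  have := Fintype.ofFinite F
  obtain ⟨α, β, hind⟩ := exists_independent_triple F K
  set e := algebraMap F K
  let bad1 : (F × F × F) × (F × F × F) → K := fun x =>
    -(e x.1.2.2 - e x.2.2.2) / ((e x.1.1 + α) * (e x.2.2.1 + β) - (e x.2.1 + α) * (e x.1.2.1 + β))
  let bad2 : (F × F × F) × (F × F × F) → K := fun x =>
    -(e x.1.1 * e x.2.2.1 - e x.2.1 * e x.1.2.1) /
      (e (x.1.2.2 - x.2.2.2) + e (x.1.2.1 - x.2.2.1) * α + e (x.2.1 - x.1.1) * β)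
  let bad3 : F × F → K := fun x => e x.2 / (e x.1 + α)
  obtain ⟨l, hl⟩ := Infinite.exists_notMem_finset
    (insert 0 (univ.image bad1 ∪ univ.image bad2 ∪ univ.image bad3))
  simp only [mem_insert, mem_union, mem_image, mem_univ, true_and, not_or, not_exists,
    Prod.forall, bad1, bad2, bad3] at hl
  obtain ⟨hl0, ⟨hl1, hl2⟩, hl3⟩ := hl
  refine ⟨fun q => (l * (e q.1 + α), e q.2.1 + β, e q.2.2),
    fun q => (e q.1, e q.2.1 / l, e q.2.2 + α * e q.2.1 - β * e q.1), ?_, ?_, ?_, ?_⟩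
  · rintro ⟨t, u, w⟩ ⟨t', u', w'⟩
    unfold LineAdj
    rw [← map_eq_zero_iff e (algebraMap F K).injective]
    simp only [map_add, map_sub, map_mul]
    refine Eq.congr_left ?_
    field_simp
    ring
  · rintro ⟨t, u, w⟩ ⟨t', u', w'⟩ h
    unfold LineAdj at h
    simp only at h
    by_cases h0 : (e t + α) * (e u' + β) - (e t' + α) * (e u + β) = 0
    · have h1 := hind (t * u' - t' * u) (u' - u) (t - t') (by
        simp only [map_sub, map_mul]
        linear_combination h0)
      have hu : u' = u := sub_eq_zero.mp h1.2.1
      have ht : t = t' := sub_eq_zero.mp h1.2.2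
      have hw : e w = e w' := by linear_combination h - l * h0
      rw [(algebraMap F K).injective hw, hu, ht]
    · refine absurd ?_ (hl1 t u w t' u' w')
      rw [div_eq_iff h0]
      linear_combination -h
  · rintro ⟨t, u, w⟩ ⟨t', u', w'⟩ h
    unfold LineAdj at h
    simp only at h
    by_cases h0 : e (w - w') + e (u - u') * α + e (t' - t) * β = 0
    · have h1 := hind _ _ _ h0
      rw [sub_eq_zero.mp h1.1, sub_eq_zero.mp h1.2.1, sub_eq_zero.mp h1.2.2]
    · refine absurd ?_ (hl2 t u w t' u' w')
      rw [div_eq_iff h0]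
      simp only [map_sub]
      field_simp at h
      linear_combination -h
  · rintro ⟨t, u, w⟩ ⟨t', u', w'⟩ h
    simp only at h
    have h0 : e t + α ≠ 0 := by
      intro h0
      have := hind t 1 0 (by simpa using h0)
      simp at this
    refine hl3 t t' ?_
    rw [div_eq_iff h0]
    exact h.symm

/-- Adjacent pairs within a set of at most `s²` lines over `𝔽_p`. -/
theorem sum_card_lineAdj_le {p : ℕ} [Fact p.Prime] (L : Finset (ZMod p × ZMod p × ZMod p))
    {κ s : ℕ} (hκ : ∀ q ∈ L, ∀ r ∈ L, q ≠ r → #{m ∈ L | LineAdj q m ∧ LineAdj r m} ≤ κ)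
    (hs : 1 ≤ s) (hsp : s ≤ p) (hκs : κ ≤ s) (hL : #L ≤ s ^ 2) :
    ∑ q ∈ L, #{m ∈ L | LineAdj q m} ≤ 294 * s ^ 3 := by
  classical
  obtain ⟨f, g, hfg, hf, hg, hdir⟩ :=
    exists_generic_embeddings (ZMod p) (AlgebraicClosure (ZMod p))
  have := AlgebraicClosure.instCharP (k := ZMod p) (p := p)
  have hself : ∀ q : AlgebraicClosure (ZMod p) × AlgebraicClosure (ZMod p) ×
      AlgebraicClosure (ZMod p), LineAdj q q := fun q => by
    unfold LineAdj
    ring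
  have hfi : Function.Injective f := fun q r h => hf q r (h ▸ hself _)
  have hgi : Function.Injective g := fun q r h => hg q r (h ▸ hself _)
  have hconf : LineConfig κ (L.image f) (L.image g) := by
    constructor
    · simp only [forall_mem_image]
      exact fun q _ r _ h => congrArg f (hf q r h)
    · simp only [forall_mem_image]
      exact fun q _ r _ h => congrArg g (hg q r h)
    · simp only [forall_mem_image]
      exact fun q _ r _ => hdir q r
    · simp only [forall_mem_image]
      intro q hq r hr hqr
      rw [filter_image, card_image_of_injective _ hgi]
      simp only [hfg]
      exact hκ q hq r hr fun h => hqr (h ▸ rfl)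
    · simp only [forall_mem_image]
      intro q hq r hr hqr
      rw [filter_image, card_image_of_injective _ hfi]
      simp only [lineAdj_comm (q := g _), hfg]
      simp only [lineAdj_comm (r := q), lineAdj_comm (r := r)]
      exact hκ q hq r hr fun h => hqr (h ▸ rfl)
  have := hconf.card_adj_le p hs hsp hκs (card_image_le.trans hL) (card_image_le.trans hL)
  rw [sum_image hfi.injOn] at this
  refine (sum_le_sum fun q _ => ?_).trans this
  rw [filter_image, card_image_of_injective _ hgi]
  simp only [hfg]
  rfl

end Generic

section Energy

variable {p : ℕ}

/-- The number of representations of `x` as a difference of squares of elements of `A`. -/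
def sqRep (A : Finset (ZMod p)) (x : ZMod p) : ℕ := #{z ∈ A ×ˢ A | z.1 ^ 2 - z.2 ^ 2 = x}

/-- The number of coincidences between differences of squares of `A` and differences of `C`. -/
def sqEnergy (A C : Finset (ZMod p)) : ℕ := ∑ y ∈ C ×ˢ C, sqRep A (y.1 - y.2)

lemma sqEnergy_eq_card (A C : Finset (ZMod p)) : sqEnergy A C =
    #{t ∈ (A ×ˢ A) ×ˢ (C ×ˢ C) | t.1.1 ^ 2 - t.1.2 ^ 2 = t.2.1 - t.2.2} := by
  rw [card_filter, sum_product_right]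
  simp only [sqEnergy, sqRep, card_filter]

lemma card_le_card_sub_self (A : Finset (ZMod p)) : #A ≤ #(A - A) := by
  rcases A.eq_empty_or_nonempty with rfl | h
  · simp
  · exact card_le_card_sub_right h

variable [Fact p.Prime]

lemma card_filter_sq_eq_le (A : Finset (ZMod p)) (x : ZMod p) : #{a ∈ A | a ^ 2 = x} ≤ 2 := by
  rcases ({a ∈ A | a ^ 2 = x} : Finset (ZMod p)).eq_empty_or_nonempty with h | ⟨b, hb⟩
  · simp [h]
  · refine (card_le_card (t := {b, -b}) fun a ha => ?_).trans card_le_two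
    rw [mem_filter] at ha hb
    simpa using sq_eq_sq_iff_eq_or_eq_neg.mp (ha.2.trans hb.2.symm)

lemma sqRep_le (A : Finset (ZMod p)) (x : ZMod p) : sqRep A x ≤ 2 * #A := by
  rw [sqRep, card_filter, sum_product, mul_comm, ← smul_eq_mul, ← sum_const]
  refine sum_le_sum fun a _ => ?_
  rw [← card_filter]
  refine le_trans (card_le_card fun c hc => ?_) (card_filter_sq_eq_le A (a ^ 2 - x))
  rw [mem_filter] at hc ⊢
  exact ⟨hc.1, by linear_combination -hc.2⟩

lemma sqEnergy_le (A C : Finset (ZMod p)) : sqEnergy A C ≤ 2 * #A * #C ^ 2 := by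
  refine (sum_le_card_nsmul _ _ _ fun y _ => sqRep_le A _).trans_eq ?_
  rw [card_product, smul_eq_mul]
  ring

/-- The lines encoding the coincidences counted by `sqEnergy`. -/
def energyLine (z : ZMod p × ZMod p × ZMod p) : ZMod p × ZMod p × ZMod p :=
  (z.1, 2 * z.2.1, z.1 ^ 2 - z.2.1 ^ 2 + z.2.2)

lemma energyLine_injective (hp : p ≠ 2) : Function.Injective (energyLine (p := p)) := by
  have h2 : (2 : ZMod p) ≠ 0 := Ring.two_ne_zero (by rwa [ZMod.ringChar_zmod_n])
  rintro ⟨x, a, b⟩ ⟨x', a', b'⟩ h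
  simp only [energyLine, Prod.mk.injEq] at h
  obtain ⟨rfl, h1, h3⟩ := h
  obtain rfl := mul_left_cancel₀ h2 h1
  simpa using h3

lemma card_common_energyLine_le (hp : p ≠ 2) (D A C : Finset (ZMod p)) (hAD : #A ≤ #D)
    {q r : ZMod p × ZMod p × ZMod p} (hqr : q ≠ r) :
    #{m ∈ (D ×ˢ A ×ˢ C).image energyLine | LineAdj q m ∧ LineAdj r m} ≤ #D := by
  have h2 : (2 : ZMod p) ≠ 0 := Ring.two_ne_zero (by rwa [ZMod.ringChar_zmod_n])
  rw [filter_image, card_image_of_injective _ (energyLine_injective hp)]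
  obtain ⟨q1, q2, q3⟩ := q
  obtain ⟨r1, r2, r3⟩ := r
  by_cases h1 : q1 = r1
  · subst h1
    by_cases h3 : q2 = r2
    · subst h3
      rw [filter_false_of_mem]
      · simp
      · rintro z _ ⟨hz, hz'⟩
        unfold LineAdj at hz hz'
        refine hqr ?_
        have : q3 = r3 := by linear_combination hz - hz'
        rw [this]
    · refine (card_le_card_of_injOn (t := A) (fun z => z.2.1) ?_ ?_).trans hAD
      · intro z hz
        simp only [mem_coe, mem_filter, mem_product] at hz
        exact hz.1.2.1
      · rintro ⟨x, a, b⟩ hz ⟨x', a', b'⟩ hz' (rfl : a = a')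
        rw [mem_coe, mem_filter] at hz hz'
        simp only [mem_product, LineAdj, energyLine] at hz hz'
        have hx : x = x' := by
          refine mul_left_cancel₀ (sub_ne_zero.mpr h3) ?_
          linear_combination -hz.2.1 + hz.2.2 + hz'.2.1 - hz'.2.2
        subst hx
        have hb : b = b' := by linear_combination hz'.2.1 - hz.2.1
        rw [hb]
  · refine card_le_card_of_injOn (fun z => z.1) ?_ ?_
    · intro z hz
      simp only [mem_coe, mem_filter, mem_product] at hz
      exact hz.1.1
    · rintro ⟨x, a, b⟩ hz ⟨x', a', b'⟩ hz' (rfl : x = x')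
      rw [mem_coe, mem_filter] at hz hz'
      simp only [mem_product, LineAdj, energyLine] at hz hz'
      have ha : a = a' := by
        refine mul_left_cancel₀ (mul_ne_zero h2 (sub_ne_zero.mpr h1)) ?_
        linear_combination hz.2.1 - hz.2.2 - hz'.2.1 + hz'.2.2
      subst ha
      have hb : b = b' := by linear_combination hz'.2.1 - hz.2.1
      rw [hb]

lemma sq_card_mul_sqEnergy_le (hp : p ≠ 2) (A C : Finset (ZMod p)) :
    #A ^ 2 * sqEnergy A C ≤ ∑ q ∈ ((A - A) ×ˢ A ×ˢ C).image energyLine,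
      #{m ∈ ((A - A) ×ˢ A ×ˢ C).image energyLine | LineAdj q m} := by
  have h2 : (2 : ZMod p) ≠ 0 := Ring.two_ne_zero (by rwa [ZMod.ringChar_zmod_n])
  set L := ((A - A) ×ˢ A ×ˢ C).image energyLine with hL
  have hR : ∑ q ∈ L, #{m ∈ L | LineAdj q m} = #{z ∈ L ×ˢ L | LineAdj z.1 z.2} := by
    simp only [card_filter, sum_product]
  rw [hR, sqEnergy_eq_card, sq, ← card_product, ← card_product]
  refine card_le_card_of_injOn (fun t =>
    (energyLine (t.2.1.1 - t.1.1, t.1.2, t.2.2.2),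
      energyLine (t.2.1.2 - t.1.2, t.1.1, t.2.2.1))) ?_ ?_
  · rintro ⟨⟨a1, a2⟩, ⟨a, c⟩, y1, y2⟩ h
    simp only [mem_coe, mem_product, mem_filter] at h
    obtain ⟨⟨h1, h2⟩, ⟨⟨h3, h4⟩, h5, h6⟩, h7⟩ := h
    simp only [mem_coe, mem_filter, mem_product, hL]
    refine ⟨⟨mem_image_of_mem _ ?_, mem_image_of_mem _ ?_⟩, ?_⟩
    · simp only [mem_product]
      exact ⟨sub_mem_sub h3 h1, h2, h6⟩
    · simp only [mem_product]
      exact ⟨sub_mem_sub h4 h2, h1, h5⟩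
    · simp only [LineAdj, energyLine]
      linear_combination h7
  · rintro ⟨⟨a1, a2⟩, ⟨a, c⟩, y1, y2⟩ _ ⟨⟨b1, b2⟩, ⟨b, d⟩, z1, z2⟩ _ h
    simp only [Prod.mk.injEq, (energyLine_injective hp).eq_iff] at h
    obtain ⟨⟨h1, rfl, rfl⟩, h2, rfl, rfl⟩ := h
    simp_all

/-- The energy bound coming from incidences of lines. -/
theorem sqEnergy_sq_mul_le (hp : p ≠ 2) (A C : Finset (ZMod p))
    (hn : #A * #(A - A) * #C ≤ p ^ 2) :
    sqEnergy A C ^ 2 * #A ≤ 2352 ^ 2 * #(A - A) ^ 3 * #C ^ 3 := by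
  have hE := sqEnergy_le A C
  have hAD := card_le_card_sub_self A
  rcases C.eq_empty_or_nonempty with rfl | hC
  · simp [sqEnergy]
  rcases A.eq_empty_or_nonempty with rfl | hA
  · simp
  have hC := hC.card_pos
  have hA := hA.card_pos
  have hcount := sq_card_mul_sqEnergy_le hp A C
  have hcod := fun q (_ : q ∈ ((A - A) ×ˢ A ×ˢ C).image energyLine) r
    (_ : r ∈ ((A - A) ×ˢ A ×ˢ C).image energyLine) (hqr : q ≠ r) =>
      card_common_energyLine_le hp (A - A) A C hAD hqr
  have hLc : #(((A - A) ×ˢ A ×ˢ C).image energyLine) = #A * #(A - A) * #C := by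
    rw [card_image_of_injective _ (energyLine_injective hp), card_product, card_product]
    ring
  generalize sqEnergy A C = E at *
  generalize hD : #(A - A) = D at *
  generalize hN : #A = N at *
  generalize #C = M at *
  rcases lt_or_ge (N * M) D with hlt | hge
  · calc E ^ 2 * N ≤ (2 * N * M ^ 2) ^ 2 * N := by gcongr
      _ = 4 * (N * M) ^ 3 * M := by ring
      _ ≤ 2352 ^ 2 * D ^ 3 * M ^ 3 := by
        gcongr
        · norm_num
        · exact Nat.le_self_pow (by norm_num) M
  · have hD0 : 0 < D := hA.trans_le hAD
    have hn0 : 0 < N * D * M := by positivity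
    obtain ⟨s, hs⟩ : ∃ s, s = (N * D * M - 1).sqrt + 1 := ⟨_, rfl⟩
    have hs1 : N * D * M ≤ s ^ 2 := by
      have := Nat.lt_succ_sqrt' (N * D * M - 1)
      rw [hs]
      simp only [Nat.succ_eq_add_one] at this
      omega
    have hs2 : (s - 1) ^ 2 < N * D * M := by
      have := Nat.sqrt_le' (N * D * M - 1)
      rw [hs, Nat.add_sub_cancel]
      omega
    have hs3 : 1 ≤ s := by omega
    have hsp : s ≤ p := by
      have : s - 1 < p := lt_of_pow_lt_pow_left₀ 2 (by omega) (hs2.trans_le hn)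
      omega
    have hDs : D ≤ s := by
      refine (Nat.pow_le_pow_iff_left two_ne_zero).mp ?_
      nlinarith
    have hs4 : s ^ 2 ≤ 4 * (N * D * M) := by
      obtain ⟨t, rfl⟩ : ∃ t, s = t + 1 := ⟨s - 1, by omega⟩
      rw [Nat.add_sub_cancel] at hs2
      rcases Nat.eq_zero_or_pos t with rfl | ht
      · omega
      · nlinarith
    have key := hcount.trans (sum_card_lineAdj_le _ hcod hs3 hsp hDs (hLc.trans_le hs1))
    have hN3 : 0 < N ^ 3 := by positivity
    refine Nat.le_of_mul_le_mul_left ?_ hN3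
    calc N ^ 3 * (E ^ 2 * N) = (N ^ 2 * E) ^ 2 := by ring
      _ ≤ (294 * s ^ 3) ^ 2 := by gcongr
      _ = 294 ^ 2 * (s ^ 2) ^ 3 := by ring
      _ ≤ 294 ^ 2 * (4 * (N * D * M)) ^ 3 := by gcongr
      _ = N ^ 3 * (2352 ^ 2 * D ^ 3 * M ^ 3) := by ring

end Energy

section FourthMoment

variable {p : ℕ}

lemma sq_sub_sq_mem_sqDiff {A : Finset (ZMod p)} {a b : ZMod p} (ha : a ∈ A) (hb : b ∈ A) :
    a ^ 2 - b ^ 2 ∈ sqDiff A :=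
  sub_mem_sub (mem_image_of_mem _ ha) (mem_image_of_mem _ hb)

lemma sum_sqRep_mul (A : Finset (ZMod p)) (f : ZMod p → ℕ) :
    ∑ x ∈ sqDiff A, sqRep A x * f x = ∑ z ∈ A ×ˢ A, f (z.1 ^ 2 - z.2 ^ 2) := by
  rw [← sum_fiberwise_of_maps_to (s := A ×ˢ A) (t := sqDiff A)
    (g := fun z : ZMod p × ZMod p => z.1 ^ 2 - z.2 ^ 2)]
  · refine sum_congr rfl fun x _ => ?_
    rw [sqRep, ← smul_eq_mul, ← sum_const]
    refine sum_congr rfl fun z hz => ?_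
    rw [(mem_filter.mp hz).2]
  · intro z hz
    rw [mem_product] at hz
    exact sq_sub_sq_mem_sqDiff hz.1 hz.2

variable [Fact p.Prime]

lemma sq_sum_sqRep_le (A Y : Finset (ZMod p)) :
    (∑ y ∈ Y, sqRep A y) ^ 2 ≤ 2 * #A * sqEnergy A Y := by
  have h1 : ∑ y ∈ Y, sqRep A y = ∑ c ∈ A, #{z ∈ A ×ˢ Y | z.1 ^ 2 - z.2 = c ^ 2} := by
    simp only [sqRep, card_filter, sum_product, sum_comm (s := Y)]
    rw [sum_comm]
    refine sum_congr rfl fun c _ => sum_congr rfl fun a _ => sum_congr rfl fun y _ => ?_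
    congr 1
    exact propext ⟨fun h => by linear_combination h, fun h => by linear_combination h⟩
  have h2 : ∀ c ∈ A, #{z ∈ A ×ˢ Y | z.1 ^ 2 - z.2 = c ^ 2} ^ 2 =
      #{t ∈ (A ×ˢ A) ×ˢ (Y ×ˢ Y) | t.1.1 ^ 2 - t.2.1 = c ^ 2 ∧ t.1.2 ^ 2 - t.2.2 = c ^ 2} := by
    intro c _
    rw [sq, ← card_product]
    refine card_nbij' (fun z => ((z.1.1, z.2.1), (z.1.2, z.2.2)))
      (fun z => ((z.1.1, z.2.1), (z.1.2, z.2.2))) ?_ ?_ (fun _ _ => rfl) (fun _ _ => rfl)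
    · intro z hz
      simp only [mem_coe, mem_product, mem_filter] at hz ⊢
      tauto
    · intro z hz
      simp only [mem_coe, mem_product, mem_filter] at hz ⊢
      tauto
  have h3 := sum_card_bipartiteAbove_eq_sum_card_bipartiteBelow (s := A)
    (t := (A ×ˢ A) ×ˢ (Y ×ˢ Y))
    (fun c t => t.1.1 ^ 2 - t.2.1 = c ^ 2 ∧ t.1.2 ^ 2 - t.2.2 = c ^ 2)
  simp only [bipartiteAbove, bipartiteBelow] at h3
  have h4 : ∑ t ∈ (A ×ˢ A) ×ˢ (Y ×ˢ Y),
      #{c ∈ A | t.1.1 ^ 2 - t.2.1 = c ^ 2 ∧ t.1.2 ^ 2 - t.2.2 = c ^ 2} ≤ 2 * sqEnergy A Y := by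
    rw [sqEnergy_eq_card, card_filter, mul_sum]
    refine sum_le_sum fun t _ => ?_
    split_ifs with h
    · refine le_trans (card_le_card fun c hc => ?_) (card_filter_sq_eq_le A (t.1.1 ^ 2 - t.2.1))
      rw [mem_filter] at hc ⊢
      exact ⟨hc.1, hc.2.1.symm⟩
    · rw [mul_zero, Nat.le_zero, card_eq_zero, filter_eq_empty_iff]
      rintro c _ ⟨hc, hc'⟩
      exact h (by linear_combination hc - hc')
  calc (∑ y ∈ Y, sqRep A y) ^ 2
      ≤ #A * ∑ c ∈ A, #{z ∈ A ×ˢ Y | z.1 ^ 2 - z.2 = c ^ 2} ^ 2 := by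
        rw [h1]
        exact sq_sum_le_card_mul_sum_sq
    _ ≤ #A * (2 * sqEnergy A Y) := by
        rw [sum_congr rfl h2, h3]
        gcongr
    _ = _ := by ring

lemma pow_mul_card_level_le (hp : p ≠ 2) (A : Finset (ZMod p))
    (hn : #A * #(A - A) * #(sqDiff A) ≤ p ^ 2) (k : ℕ) :
    k ^ 4 * #{x ∈ sqDiff A | k ≤ sqRep A x} ≤ 4 * 2352 ^ 2 * #A * #(A - A) ^ 3 := by
  set Y : Finset (ZMod p) := {x ∈ sqDiff A | k ≤ sqRep A x} with hY
  rcases Nat.eq_zero_or_pos #Y with h0 | h0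
  · rw [h0, mul_zero]
    exact Nat.zero_le _
  have h1 : #Y * k ≤ ∑ y ∈ Y, sqRep A y := by
    rw [← smul_eq_mul, ← sum_const]
    exact sum_le_sum fun y hy => (mem_filter.mp hy).2
  have h2 := sq_sum_sqRep_le A Y
  have h3 := sqEnergy_sq_mul_le hp A Y
    ((Nat.mul_le_mul_left _ (card_le_card (filter_subset _ _))).trans hn)
  have h4 : 0 < #Y ^ 3 := by positivity
  refine Nat.le_of_mul_le_mul_left ?_ h4
  calc #Y ^ 3 * (k ^ 4 * #Y) = ((#Y * k) ^ 2) ^ 2 := by ring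
    _ ≤ (2 * #A * sqEnergy A Y) ^ 2 := by
      gcongr
      exact (Nat.pow_le_pow_left h1 2).trans h2
    _ = 4 * #A * (sqEnergy A Y ^ 2 * #A) := by ring
    _ ≤ 4 * #A * (2352 ^ 2 * #(A - A) ^ 3 * #Y ^ 3) := by gcongr
    _ = _ := by ring

lemma pow_four_le_sum_cubes (n : ℕ) : n ^ 4 ≤ 4 * ∑ k ∈ Icc 1 n, k ^ 3 := by
  induction n with
  | zero => simp
  | succ n ih =>
    rw [sum_Icc_succ_top (by omega), mul_add]
    have h : (n + 1) ^ 4 + (6 * n ^ 2 + 8 * n + 3) = n ^ 4 + 4 * (n + 1) ^ 3 := by ring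
    omega

/-- The fourth moment of the number of representations as a difference of squares. -/
lemma sum_sqRep_pow_four_le (hp : p ≠ 2) (A : Finset (ZMod p))
    (hn : #A * #(A - A) * #(sqDiff A) ≤ p ^ 2) :
    ((∑ x ∈ sqDiff A, sqRep A x ^ 4 : ℕ) : ℝ) ≤
      16 * 2352 ^ 2 * #A * #(A - A) ^ 3 * (1 + Real.log (2 * #A)) := by
  have h1 : ∑ x ∈ sqDiff A, sqRep A x ^ 4 ≤
      4 * ∑ k ∈ Icc 1 (2 * #A), k ^ 3 * #{x ∈ sqDiff A | k ≤ sqRep A x} := by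
    calc ∑ x ∈ sqDiff A, sqRep A x ^ 4
        ≤ ∑ x ∈ sqDiff A, 4 * ∑ k ∈ Icc 1 (sqRep A x), k ^ 3 :=
          sum_le_sum fun x _ => pow_four_le_sum_cubes _
      _ = 4 * ∑ x ∈ sqDiff A, ∑ k ∈ Icc 1 (2 * #A), if k ≤ sqRep A x then k ^ 3 else 0 := by
          rw [← mul_sum]
          congr 1
          refine sum_congr rfl fun x _ => ?_
          rw [← sum_filter]
          congr 1
          ext k
          have := sqRep_le A x
          simp only [mem_Icc, mem_filter]
          omega
      _ = _ := by
          rw [sum_comm]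
          congr 1
          refine sum_congr rfl fun k _ => ?_
          rw [← sum_filter, sum_const, smul_eq_mul, mul_comm]
  have h2 : ∀ k ∈ Icc 1 (2 * #A), ((k ^ 3 * #{x ∈ sqDiff A | k ≤ sqRep A x} : ℕ) : ℝ) ≤
      4 * 2352 ^ 2 * #A * #(A - A) ^ 3 * (k : ℝ)⁻¹ := by
    intro k hk
    have hk0 : (0 : ℝ) < k := by exact_mod_cast (mem_Icc.mp hk).1
    rw [← div_eq_mul_inv, le_div_iff₀ hk0]
    have := pow_mul_card_level_le hp A hn k
    calc ((k ^ 3 * #{x ∈ sqDiff A | k ≤ sqRep A x} : ℕ) : ℝ) * k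
        = ((k ^ 4 * #{x ∈ sqDiff A | k ≤ sqRep A x} : ℕ) : ℝ) := by push_cast; ring
      _ ≤ ((4 * 2352 ^ 2 * #A * #(A - A) ^ 3 : ℕ) : ℝ) := by exact_mod_cast this
      _ = _ := by push_cast; ring
  have h3 : ∑ k ∈ Icc 1 (2 * #A), (k : ℝ)⁻¹ ≤ 1 + Real.log (2 * #A) := by
    have := harmonic_le_one_add_log (2 * #A)
    rw [harmonic_eq_sum_Icc] at this
    push_cast at this
    exact this
  calc ((∑ x ∈ sqDiff A, sqRep A x ^ 4 : ℕ) : ℝ)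
      ≤ 4 * ∑ k ∈ Icc 1 (2 * #A), ((k ^ 3 * #{x ∈ sqDiff A | k ≤ sqRep A x} : ℕ) : ℝ) := by
        exact_mod_cast h1
    _ ≤ 4 * ∑ k ∈ Icc 1 (2 * #A), 4 * 2352 ^ 2 * #A * #(A - A) ^ 3 * (k : ℝ)⁻¹ := by
        gcongr with k hk
        exact h2 k hk
    _ ≤ 4 * (4 * 2352 ^ 2 * #A * #(A - A) ^ 3 * (1 + Real.log (2 * #A))) := by
        rw [← mul_sum]
        gcongr
    _ = _ := by ring

end FourthMoment

section Classes

lemma card_sq_le_card_image_mul {α β : Type*} [DecidableEq β] (G : Finset α) (f : α → β) :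
    #G ^ 2 ≤ #(G.image f) * #{w ∈ G ×ˢ G | f w.2 = f w.1} := by
  have h1 : #G = ∑ y ∈ G.image f, #{w ∈ G | f w = y} := card_eq_sum_card_image f G
  have h2 : #{w ∈ G ×ˢ G | f w.2 = f w.1} = ∑ y ∈ G.image f, #{w ∈ G | f w = y} ^ 2 := by
    rw [card_filter, sum_product, ← sum_fiberwise_of_maps_to (s := G) (t := G.image f) (g := f)
      (fun w hw => mem_image_of_mem f hw)]
    refine sum_congr rfl fun y _ => ?_
    rw [sq, ← smul_eq_mul, ← sum_const]
    refine sum_congr rfl fun w hw => ?_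
    rw [← (mem_filter.mp hw).2, card_filter]
  rw [h2, h1]
  exact sq_sum_le_card_mul_sum_sq

variable {p : ℕ}

/-- The elements of `S` that stay in `S` when translated by `x`. -/
def overlap (S : Finset (ZMod p)) (x : ZMod p) : Finset (ZMod p) := {y ∈ S | y + x ∈ S}

lemma mem_overlap {S : Finset (ZMod p)} {x y : ZMod p} :
    y ∈ overlap S x ↔ y ∈ S ∧ y + x ∈ S := by
  simp [overlap]

lemma sum_card_overlap (A S : Finset (ZMod p)) :
    ∑ z ∈ A ×ˢ A, #(overlap S (z.1 ^ 2 - z.2 ^ 2)) = sqEnergy A S := by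
  rw [sqEnergy_eq_card, card_filter, sum_product (A ×ˢ A)]
  refine sum_congr rfl fun z _ => ?_
  rw [← card_filter]
  refine card_nbij' (fun y => (y + (z.1 ^ 2 - z.2 ^ 2), y)) (fun y => y.2) ?_ ?_ ?_ ?_
  · intro y hy
    rw [mem_coe, mem_overlap] at hy
    simp only [mem_coe, mem_filter, mem_product, add_sub_cancel_left, and_true]
    exact hy.symm
  · intro y hy
    simp only [mem_coe, mem_filter, mem_product] at hy
    rw [mem_coe, mem_overlap, hy.2, add_sub_cancel]
    exact hy.1.symm
  · exact fun _ _ => rfl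
  · intro y hy
    simp only [mem_coe, mem_filter, mem_product] at hy
    simp only [hy.2, add_sub_cancel]

/-- The pairs from `A` whose difference of squares is popular and has small overlap. -/
def goodPairs (A : Finset (ZMod p)) : Finset (ZMod p × ZMod p) :=
  {z ∈ A ×ˢ A | #A ^ 2 ≤ 8 * #(sqDiff A) * sqRep A (z.1 ^ 2 - z.2 ^ 2) ∧
    #A ^ 2 * #(overlap (sqDiff A) (z.1 ^ 2 - z.2 ^ 2)) ≤ 8 * sqEnergy A (sqDiff A)}

lemma card_unpopular_le (A : Finset (ZMod p)) :
    8 * #{z ∈ A ×ˢ A | 8 * #(sqDiff A) * sqRep A (z.1 ^ 2 - z.2 ^ 2) < #A ^ 2} ≤ #A ^ 2 := by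
  rcases A.eq_empty_or_nonempty with rfl | ⟨a, ha⟩
  · simp
  have hS : 0 < #(sqDiff A) := card_pos.mpr ⟨_, sq_sub_sq_mem_sqDiff ha ha⟩
  refine Nat.le_of_mul_le_mul_left ?_ hS
  rw [card_filter, ← sum_sqRep_mul A fun x => if 8 * #(sqDiff A) * sqRep A x < #A ^ 2 then 1 else 0,
    ← mul_assoc, mul_sum, ← smul_eq_mul (#(sqDiff A)) (#A ^ 2), ← sum_const]
  refine sum_le_sum fun x _ => ?_
  split_ifs with h
  · nlinarith
  · simp

lemma card_large_overlap_le (A S : Finset (ZMod p)) :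
    8 * #{z ∈ A ×ˢ A | 8 * sqEnergy A S < #A ^ 2 * #(overlap S (z.1 ^ 2 - z.2 ^ 2))} ≤ #A ^ 2 := by
  set B : Finset (ZMod p × ZMod p) :=
    {z ∈ A ×ˢ A | 8 * sqEnergy A S < #A ^ 2 * #(overlap S (z.1 ^ 2 - z.2 ^ 2))} with hB
  have h1 := sum_card_overlap A S
  rcases Nat.eq_zero_or_pos (sqEnergy A S) with h0 | h0
  · rw [h0, sum_eq_zero_iff] at h1
    have : B = ∅ := by
      rw [hB, filter_eq_empty_iff]
      intro z hz
      rw [h1 z hz]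
      simp
    simp [this]
  · refine Nat.le_of_mul_le_mul_left ?_ h0
    calc sqEnergy A S * (8 * #B) = ∑ _z ∈ B, 8 * sqEnergy A S := by
          rw [sum_const, smul_eq_mul]
          ring
      _ ≤ ∑ z ∈ B, #A ^ 2 * #(overlap S (z.1 ^ 2 - z.2 ^ 2)) :=
          sum_le_sum fun z hz => (mem_filter.mp hz).2.le
      _ ≤ ∑ z ∈ A ×ˢ A, #A ^ 2 * #(overlap S (z.1 ^ 2 - z.2 ^ 2)) :=
          sum_le_sum_of_subset (filter_subset _ _)
      _ = sqEnergy A S * #A ^ 2 := by rw [← mul_sum, h1, mul_comm]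

lemma three_mul_le_card_goodPairs (A : Finset (ZMod p)) : 3 * #A ^ 2 ≤ 4 * #(goodPairs A) := by
  have h1 := card_unpopular_le A
  have h2 := card_large_overlap_le A (sqDiff A)
  have h3 : A ×ˢ A ⊆ goodPairs A ∪
      ({z ∈ A ×ˢ A | 8 * #(sqDiff A) * sqRep A (z.1 ^ 2 - z.2 ^ 2) < #A ^ 2} ∪
      {z ∈ A ×ˢ A | 8 * sqEnergy A (sqDiff A) <
        #A ^ 2 * #(overlap (sqDiff A) (z.1 ^ 2 - z.2 ^ 2))}) := by
    intro z hz
    simp only [goodPairs, mem_union, mem_filter, hz, true_and]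
    omega
  have h4 := card_le_card h3
  have h5 := card_union_le (goodPairs A)
      ({z ∈ A ×ˢ A | 8 * #(sqDiff A) * sqRep A (z.1 ^ 2 - z.2 ^ 2) < #A ^ 2} ∪
      {z ∈ A ×ˢ A | 8 * sqEnergy A (sqDiff A) <
        #A ^ 2 * #(overlap (sqDiff A) (z.1 ^ 2 - z.2 ^ 2))})
  have h6 := card_union_le
      {z ∈ A ×ˢ A | 8 * #(sqDiff A) * sqRep A (z.1 ^ 2 - z.2 ^ 2) < #A ^ 2}
      {z ∈ A ×ˢ A | 8 * sqEnergy A (sqDiff A) <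
        #A ^ 2 * #(overlap (sqDiff A) (z.1 ^ 2 - z.2 ^ 2))}
  rw [card_product] at h4
  nlinarith

/-- The differences of squares `a² - b²`, `b² - c²`, `b² - d²` of a quadruple. -/
def quadClass (w : (ZMod p × ZMod p) × (ZMod p × ZMod p)) : ZMod p × ZMod p × ZMod p :=
  (w.1.1 ^ 2 - w.1.2 ^ 2, w.1.2 ^ 2 - w.2.1 ^ 2, w.1.2 ^ 2 - w.2.2 ^ 2)

lemma card_collisions_le (A : Finset (ZMod p)) {Q : Finset ((ZMod p × ZMod p) × (ZMod p × ZMod p))}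
    (hQ : Q ⊆ (A ×ˢ A) ×ˢ (A ×ˢ A)) :
    #{w ∈ Q ×ˢ Q | quadClass w.2 = quadClass w.1} ≤ ∑ x ∈ sqDiff A, sqRep A x ^ 4 := by
  have h1 : ∑ x ∈ sqDiff A, sqRep A x ^ 4 = #((sqDiff A).sigma fun x =>
      ({z ∈ A ×ˢ A | z.1 ^ 2 - z.2 ^ 2 = x} ×ˢ {z ∈ A ×ˢ A | z.1 ^ 2 - z.2 ^ 2 = x}) ×ˢ
      ({z ∈ A ×ˢ A | z.1 ^ 2 - z.2 ^ 2 = x} ×ˢ {z ∈ A ×ˢ A | z.1 ^ 2 - z.2 ^ 2 = x})) := by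
    rw [card_sigma]
    refine sum_congr rfl fun x _ => ?_
    simp only [card_product, sqRep]
    ring
  rw [h1]
  refine card_le_card_of_injOn (fun w => ⟨w.1.1.1 ^ 2 - w.2.1.1 ^ 2,
    ((w.1.1.1, w.2.1.1), (w.1.1.2, w.2.1.2)), ((w.1.2.1, w.2.2.1), (w.1.2.2, w.2.2.2))⟩) ?_ ?_
  · rintro ⟨⟨⟨a, b⟩, c, d⟩, ⟨a', b'⟩, c', d'⟩ hw
    simp only [mem_coe, mem_filter, mem_product, quadClass, Prod.mk.injEq] at hw
    obtain ⟨⟨hq, hq'⟩, e1, e2, e3⟩ := hw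
    have hq := hQ hq
    have hq' := hQ hq'
    simp only [mem_product] at hq hq'
    obtain ⟨⟨ha, hb⟩, hc, hd⟩ := hq
    obtain ⟨⟨ha', hb'⟩, hc', hd'⟩ := hq'
    simp only [mem_coe, mem_sigma, mem_product, mem_filter]
    refine ⟨sq_sub_sq_mem_sqDiff ha ha', ⟨⟨⟨ha, ha'⟩, trivial⟩, ⟨hb, hb'⟩, ?_⟩,
      ⟨⟨hc, hc'⟩, ?_⟩, ⟨hd, hd'⟩, ?_⟩
    · linear_combination e1
    · linear_combination e1 + e2
    · linear_combination e1 + e3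
  · rintro ⟨⟨⟨a, b⟩, c, d⟩, ⟨a', b'⟩, c', d'⟩ _ ⟨⟨⟨a1, b1⟩, c1, d1⟩, ⟨a2, b2⟩, c2, d2⟩ _ h
    rw [Sigma.mk.injEq] at h
    have h' := eq_of_heq h.2
    simp only [Prod.mk.injEq] at h' ⊢
    tauto

lemma card_popular_mul_le (A T : Finset (ZMod p)) {n k : ℕ} :
    #{y ∈ T ×ˢ T | n ≤ k * sqRep A (y.1 - y.2)} * n ≤ k * sqEnergy A T := by
  calc #{y ∈ T ×ˢ T | n ≤ k * sqRep A (y.1 - y.2)} * n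
      ≤ ∑ y ∈ T ×ˢ T with n ≤ k * sqRep A (y.1 - y.2), k * sqRep A (y.1 - y.2) := by
        rw [← smul_eq_mul, ← sum_const]
        exact sum_le_sum fun y hy => (mem_filter.mp hy).2
    _ ≤ ∑ y ∈ T ×ˢ T, k * sqRep A (y.1 - y.2) := sum_le_sum_of_subset (filter_subset _ _)
    _ = _ := by rw [← mul_sum, sqEnergy]

lemma card_image_quadClass_mul_le (A : Finset (ZMod p)) {W : ℕ}
    (hW : ∀ x, #A ^ 2 * #(overlap (sqDiff A) x) ≤ 8 * sqEnergy A (sqDiff A) →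
      sqEnergy A (overlap (sqDiff A) x) ≤ W) :
    #((goodPairs A ×ˢ goodPairs A).image quadClass) * #A ^ 2 ≤ 8 * #(sqDiff A) ^ 2 * W := by
  set P : Finset (ZMod p) := {x ∈ sqDiff A |
    #A ^ 2 * #(overlap (sqDiff A) x) ≤ 8 * sqEnergy A (sqDiff A)} with hP
  have h1 : #((goodPairs A ×ˢ goodPairs A).image quadClass) ≤ ∑ x ∈ P,
      #{y ∈ overlap (sqDiff A) x ×ˢ overlap (sqDiff A) x |
        #A ^ 2 ≤ 8 * #(sqDiff A) * sqRep A (y.1 - y.2)} := by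
    rw [← card_sigma]
    refine card_le_card_of_injOn (fun t => ⟨t.1, t.2.2, t.2.1⟩) ?_ ?_
    · intro t ht
      obtain ⟨⟨⟨a, b⟩, c, d⟩, hw, rfl⟩ := mem_image.mp ht
      simp only [goodPairs, mem_product, mem_filter] at hw
      obtain ⟨⟨⟨ha, hb⟩, -, hab⟩, ⟨hc, hd⟩, hcd, -⟩ := hw
      simp only [quadClass, mem_coe, mem_sigma, mem_product, mem_filter, mem_overlap, hP]
      refine ⟨⟨sq_sub_sq_mem_sqDiff ha hb, hab⟩, ⟨⟨sq_sub_sq_mem_sqDiff hb hd, ?_⟩,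
        sq_sub_sq_mem_sqDiff hb hc, ?_⟩, ?_⟩
      · rw [add_comm, sub_add_sub_cancel]
        exact sq_sub_sq_mem_sqDiff ha hd
      · rw [add_comm, sub_add_sub_cancel]
        exact sq_sub_sq_mem_sqDiff ha hc
      · rwa [sub_sub_sub_cancel_left]
    · rintro ⟨x, u, v⟩ _ ⟨x', u', v'⟩ _ h
      rw [Sigma.mk.injEq] at h
      have h' := eq_of_heq h.2
      simp only [Prod.mk.injEq] at h' ⊢
      tauto
  calc #((goodPairs A ×ˢ goodPairs A).image quadClass) * #A ^ 2
      ≤ (∑ x ∈ P, #{y ∈ overlap (sqDiff A) x ×ˢ overlap (sqDiff A) x |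
        #A ^ 2 ≤ 8 * #(sqDiff A) * sqRep A (y.1 - y.2)}) * #A ^ 2 := by gcongr
    _ ≤ ∑ _x ∈ P, 8 * #(sqDiff A) * W := by
        rw [sum_mul]
        refine sum_le_sum fun x hx => (card_popular_mul_le A _).trans ?_
        gcongr
        exact hW x (mem_filter.mp hx).2
    _ ≤ #(sqDiff A) * (8 * #(sqDiff A) * W) := by
        rw [sum_const, smul_eq_mul]
        gcongr
        exact filter_subset _ _
    _ = _ := by ring

variable [Fact p.Prime]

/-- The number of classes of good quadruples. -/
lemma card_image_quadClass_pow_four_le (hp : p ≠ 2) (A : Finset (ZMod p))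
    (hn : #A * #(A - A) * #(sqDiff A) ≤ p ^ 2) :
    #((goodPairs A ×ˢ goodPairs A).image quadClass) ^ 4 * #A ^ 25 ≤
      8 ^ 10 * 2352 ^ 10 * #(A - A) ^ 15 * #(sqDiff A) ^ 17 := by
  set S := sqDiff A with hS
  set P : Finset (ZMod p) := {x | #A ^ 2 * #(overlap S x) ≤ 8 * sqEnergy A S} with hP
  set W := P.sup fun x => sqEnergy A (overlap S x) with hWdef
  have hW : W ^ 2 * #A ^ 7 ≤ 2352 ^ 2 * #(A - A) ^ 3 * (8 * sqEnergy A S) ^ 3 := by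
    rcases P.eq_empty_or_nonempty with h0 | h0
    · rw [hWdef, h0]
      simp
    · obtain ⟨x, hx, hxW⟩ := P.exists_mem_eq_sup h0 fun x => sqEnergy A (overlap S x)
      rw [hWdef, hxW]
      have h1 := sqEnergy_sq_mul_le hp A (overlap S x)
        ((Nat.mul_le_mul_left _ (card_le_card (filter_subset _ _))).trans hn)
      calc sqEnergy A (overlap S x) ^ 2 * #A ^ 7
          = sqEnergy A (overlap S x) ^ 2 * #A * (#A ^ 2) ^ 3 := by ring
        _ ≤ 2352 ^ 2 * #(A - A) ^ 3 * #(overlap S x) ^ 3 * (#A ^ 2) ^ 3 := by gcongr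
        _ = 2352 ^ 2 * #(A - A) ^ 3 * (#A ^ 2 * #(overlap S x)) ^ 3 := by ring
        _ ≤ _ := by
          have h2 := (mem_filter.mp hx).2
          gcongr _ * ?_ ^ 3
  have hI := card_image_quadClass_mul_le A (W := W) fun x hx =>
    le_sup (f := fun x => sqEnergy A (overlap S x)) (mem_filter.mpr ⟨mem_univ x, hx⟩)
  have hE := sqEnergy_sq_mul_le hp A S hn
  generalize #((goodPairs A ×ˢ goodPairs A).image quadClass) = I at *
  generalize sqEnergy A S = E at *
  calc I ^ 4 * #A ^ 25 = (I * #A ^ 2) ^ 4 * #A ^ 17 := by ring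
    _ ≤ (8 * #S ^ 2 * W) ^ 4 * #A ^ 17 := by gcongr
    _ = 8 ^ 4 * #S ^ 8 * (W ^ 2 * #A ^ 7) ^ 2 * #A ^ 3 := by ring
    _ ≤ 8 ^ 4 * #S ^ 8 * (2352 ^ 2 * #(A - A) ^ 3 * (8 * E) ^ 3) ^ 2 * #A ^ 3 := by gcongr
    _ = 8 ^ 10 * 2352 ^ 4 * #S ^ 8 * #(A - A) ^ 6 * (E ^ 2 * #A) ^ 3 := by ring
    _ ≤ 8 ^ 10 * 2352 ^ 4 * #S ^ 8 * #(A - A) ^ 6 *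
        (2352 ^ 2 * #(A - A) ^ 3 * #S ^ 3) ^ 3 := by gcongr
    _ = _ := by ring

theorem card_pow_le (hp : p ≠ 2) (A : Finset (ZMod p)) (hA : A.Nonempty)
    (hn : #A * #(A - A) * #(sqDiff A) ≤ p ^ 2) :
    (#A : ℝ) ^ 53 ≤ 4 ^ 4 * 8 ^ 10 * 16 ^ 4 * 2352 ^ 18 * (1 + Real.log (2 * #A)) ^ 4 *
      (#(A - A) ^ 27 * #(sqDiff A) ^ 17) := by
  have h1 := three_mul_le_card_goodPairs A
  have h2 := card_sq_le_card_image_mul (goodPairs A ×ˢ goodPairs A) quadClass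
  have h3 := card_collisions_le A (Q := goodPairs A ×ˢ goodPairs A)
    (product_subset_product (filter_subset _ _) (filter_subset _ _))
  have h4 := sum_sqRep_pow_four_le hp A hn
  have h5 := card_image_quadClass_pow_four_le hp A hn
  generalize #((goodPairs A ×ˢ goodPairs A).image quadClass) = I at *
  generalize ∑ x ∈ sqDiff A, sqRep A x ^ 4 = E4 at *
  rw [card_product] at h2
  have hA0 : (0 : ℝ) < #A := by exact_mod_cast hA.card_pos
  generalize Real.log (2 * #A) = L at *
  have h6 : #A ^ 8 ≤ 4 * (I * E4) := by
    have h7 : (3 * #A ^ 2) ^ 4 ≤ (4 * #(goodPairs A)) ^ 4 := Nat.pow_le_pow_left h1 4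
    have h8 := h2.trans (Nat.mul_le_mul_left I h3)
    nlinarith
  have h7 : (#A : ℝ) ^ 8 ≤ 4 * ((I : ℝ) * E4) := by exact_mod_cast h6
  have h8 : (I : ℝ) ^ 4 * #A ^ 25 ≤ 8 ^ 10 * 2352 ^ 10 * #(A - A) ^ 15 * #(sqDiff A) ^ 17 := by
    exact_mod_cast h5
  refine le_of_mul_le_mul_right ?_ (pow_pos hA0 4)
  calc (#A : ℝ) ^ 53 * #A ^ 4 = (#A ^ 8) ^ 4 * #A ^ 25 := by ring
    _ ≤ (4 * ((I : ℝ) * E4)) ^ 4 * #A ^ 25 := by gcongr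
    _ = 4 ^ 4 * ((I : ℝ) ^ 4 * #A ^ 25) * E4 ^ 4 := by ring
    _ ≤ 4 ^ 4 * (8 ^ 10 * 2352 ^ 10 * #(A - A) ^ 15 * #(sqDiff A) ^ 17) *
        (16 * 2352 ^ 2 * #A * #(A - A) ^ 3 * (1 + L)) ^ 4 := by gcongr
    _ = _ := by ring

end Classes

section Main

lemma one_add_log_pow_le {ε : ℝ} (hε : 0 < ε) {p n : ℕ} (hp : 2 ≤ p) (hn : 0 < n) (hnp : n ≤ p) :
    (1 + Real.log (2 * n)) ^ 4 ≤ (1 + 8 / ε) ^ 4 * (p : ℝ) ^ ε := by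
  have hp2 : (2 : ℝ) ≤ p := by exact_mod_cast hp
  have hn1 : (1 : ℝ) ≤ n := by exact_mod_cast hn
  have hnp' : (n : ℝ) ≤ p := by exact_mod_cast hnp
  have h0 : 0 ≤ Real.log (2 * n) := Real.log_nonneg (by linarith)
  have h1 : Real.log (2 * n) ≤ 2 * Real.log p := by
    rw [← Real.log_rpow (by linarith), Real.rpow_two]
    refine Real.log_le_log (by linarith) ?_
    nlinarith
  have h2 := Real.log_le_rpow_div (x := p) (by linarith) (ε := ε / 4) (by linarith)
  have h3 : (1 : ℝ) ≤ (p : ℝ) ^ (ε / 4) := Real.one_le_rpow (by linarith) (by linarith)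
  have h4 : (p : ℝ) ^ ε = ((p : ℝ) ^ (ε / 4)) ^ 4 := by
    rw [← Real.rpow_mul_natCast (by linarith)]
    congr 1
    push_cast
    ring
  rw [h4, ← mul_pow]
  refine pow_le_pow_left₀ (by linarith) ?_ 4
  calc 1 + Real.log (2 * n) ≤ (p : ℝ) ^ (ε / 4) + 2 * ((p : ℝ) ^ (ε / 4) / (ε / 4)) := by linarith
    _ = _ := by
      field_simp
      ring

lemma card_pow_le_rpow {ε : ℝ} (hε : 0 < ε) {p : ℕ} (hp : p.Prime) (A : Finset (ZMod p))
    (hA : A.Nonempty) (hn : #A * #(A - A) * #(sqDiff A) ≤ p ^ 2) :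
    (#A : ℝ) ^ 53 ≤ 4 ^ 4 * 8 ^ 10 * 16 ^ 4 * 2352 ^ 18 * ((1 + 8 / ε) ^ 4 * (p : ℝ) ^ ε) *
      (#(A - A) ^ 27 * #(sqDiff A) ^ 17) := by
  have : Fact p.Prime := ⟨hp⟩
  have hAp : #A ≤ p := (card_le_univ A).trans_eq (ZMod.card p)
  have hlog := one_add_log_pow_le hε hp.two_le hA.card_pos hAp
  by_cases hp2 : p = 2
  · obtain ⟨a, ha⟩ := hA
    have h1 : (1 : ℝ) ≤ #(A - A) := by exact_mod_cast card_pos.mpr ⟨_, sub_mem_sub ha ha⟩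
    have h2 : (1 : ℝ) ≤ #(sqDiff A) := by
      exact_mod_cast card_pos.mpr ⟨_, sq_sub_sq_mem_sqDiff ha ha⟩
    have h3 : (#A : ℝ) ≤ 2 := by exact_mod_cast hAp.trans_eq hp2
    have h4 : (1 : ℝ) ≤ (1 + 8 / ε) ^ 4 := one_le_pow₀ (by simp; positivity)
    have h5 : (1 : ℝ) ≤ (p : ℝ) ^ ε :=
      Real.one_le_rpow (by exact_mod_cast hp.one_le) hε.le
    calc (#A : ℝ) ^ 53 ≤ 2 ^ 53 := by gcongr
      _ ≤ 4 ^ 4 * 8 ^ 10 * 16 ^ 4 * 2352 ^ 18 * (1 * 1) * (1 ^ 27 * 1 ^ 17) := by norm_num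
      _ ≤ _ := by gcongr
  · refine (card_pow_le hp2 A hA hn).trans ?_
    gcongr

end Main

/-- For every `ε > 0` there exists `c_ε > 0` such that for every prime `p` and `A ⊆ 𝔽_p`
with `|A|·|A-A|·|A²-A²| ≤ p²`, either `|A-A|^{27}·|A²-A²|^{17} ≥ c_ε·p^{-ε}·|A|^{53}` or
`|A-A|^{13}·|A²-A²|^{7} ≥ c_ε·p^{-ε}·|A|^{25}`. -/
theorem diff_sqdiff_dichotomy (ε : ℝ) (hε : 0 < ε) :
    ∃ cε : ℝ, 0 < cε ∧
      ∀ (p : ℕ), p.Prime →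
        ∀ A : Finset (ZMod p),
          A.card * (A - A).card * (sqDiff A).card ≤ p ^ 2 →
          (((A - A).card : ℝ) ^ (27 : ℕ) * ((sqDiff A).card : ℝ) ^ (17 : ℕ) ≥
              cε * (p : ℝ) ^ (-ε) * (A.card : ℝ) ^ (53 : ℕ) ∨
            ((A - A).card : ℝ) ^ (13 : ℕ) * ((sqDiff A).card : ℝ) ^ (7 : ℕ) ≥
              cε * (p : ℝ) ^ (-ε) * (A.card : ℝ) ^ (25 : ℕ)) := by
  have hK : (0 : ℝ) < 4 ^ 4 * 8 ^ 10 * 16 ^ 4 * 2352 ^ 18 * (1 + 8 / ε) ^ 4 := by positivity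
  refine ⟨(4 ^ 4 * 8 ^ 10 * 16 ^ 4 * 2352 ^ 18 * (1 + 8 / ε) ^ 4)⁻¹, inv_pos.mpr hK,
    fun p hp A hn => Or.inl ?_⟩
  rcases A.eq_empty_or_nonempty with rfl | hA
  · simp
  have hp0 : (0 : ℝ) < p := by exact_mod_cast hp.pos
  rw [ge_iff_le, Real.rpow_neg hp0.le, ← mul_inv,
    inv_mul_le_iff₀ (mul_pos hK (Real.rpow_pos_of_pos hp0 ε))]
  refine (card_pow_le_rpow hε hp A hA hn).trans_eq ?_
  ring

end FpSumProd
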